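/- arXiv:2411.17330 — 2 statements merged into one kernel-verified Lean document; each statement's English description precedes it below -/
import Mathlib

section
/- Let g ∈ ℚ[x,z₁,…,zₙ] be an irreducible polynomial of total degree δ that is monic in x. Then there exists a nonzero polynomial G ∈ ℚ[b₁,…,bₙ,c₁,…,cₙ] in 2n variables of total degree at most 2δ⁵ such that for all β, γ ∈ ℚⁿ: if G(β,γ) ≠ 0, then the bivariate polynomial g(x, β₁t+γ₁, …, βₙt+γₙ) ∈ ℚ[x,t] is irreducible. -/
open Polynomial

/-- The partial derivative of a bivariate polynomial with respect to the inner variable. -/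
noncomputable def innerDerivative {R : Type*} [CommRing R] (p : R[X][X]) : R[X][X] :=
  Bivariate.swap (derivative (Bivariate.swap p))

section InnerDerivative

variable {R : Type*} [CommRing R]

theorem swap_innerDerivative (p : R[X][X]) :
    Bivariate.swap (innerDerivative p) = derivative (Bivariate.swap p) := by
  rw [innerDerivative, Bivariate.swap_swap_apply]

theorem innerDerivative_zero : innerDerivative (0 : R[X][X]) = 0 := by
  rw [innerDerivative, map_zero, derivative_zero, map_zero]

theorem innerDerivative_add (p q : R[X][X]) :
    innerDerivative (p + q) = innerDerivative p + innerDerivative q := by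
  simp only [innerDerivative, map_add]

theorem innerDerivative_mul (p q : R[X][X]) :
    innerDerivative (p * q) = innerDerivative p * q + p * innerDerivative q := by
  simp only [innerDerivative, map_mul, derivative_mul, map_add, Bivariate.swap_swap_apply]

theorem innerDerivative_sum {ι : Type*} (s : Finset ι) (f : ι → R[X][X]) :
    innerDerivative (∑ i ∈ s, f i) = ∑ i ∈ s, innerDerivative (f i) := by
  simp only [innerDerivative, map_sum]

theorem innerDerivative_C (a : R[X]) : innerDerivative (C a) = C (derivative a) := by
  rw [innerDerivative, Bivariate.swap_C, derivative_map, Bivariate.swap_map_C]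

theorem coeff_innerDerivative (p : R[X][X]) (i : ℕ) :
    (innerDerivative p).coeff i = derivative (p.coeff i) := by
  induction p using Polynomial.induction_on' with
  | add p q hp hq => simp only [innerDerivative_add, coeff_add, hp, hq, derivative_add]
  | monomial n a =>
    have h : innerDerivative (monomial n a) = monomial n (derivative a) := by
      apply Bivariate.swap.injective
      rw [swap_innerDerivative, Bivariate.swap_monomial, Bivariate.swap_monomial, derivative_mul,
        derivative_C, mul_zero, add_zero, derivative_map]
    rw [h, coeff_monomial, coeff_monomial]
    split_ifs <;> simp

theorem innerDerivative_derivative (p : R[X][X]) :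
    innerDerivative (derivative p) = derivative (innerDerivative p) := by
  ext i : 1
  simp only [coeff_innerDerivative, coeff_derivative]
  rw [derivative_mul]
  simp

theorem innerDerivative_map {S : Type*} [CommRing S] (φ : R →+* S) (p : R[X][X]) :
    innerDerivative (p.map (mapRingHom φ)) = (innerDerivative p).map (mapRingHom φ) := by
  ext i : 1
  simp only [coeff_innerDerivative, coeff_map, coe_mapRingHom, derivative_map]

theorem coeff_coeff_swap (p : R[X][X]) (i j : ℕ) :
    ((Bivariate.swap p).coeff j).coeff i = (p.coeff i).coeff j := by
  induction p using Polynomial.induction_on' with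
  | add p q hp hq => simp only [map_add, coeff_add, hp, hq]
  | monomial n a =>
    induction a using Polynomial.induction_on' with
    | add p q hp hq => simp only [map_add, coeff_add, hp, hq]
    | monomial m r =>
      rw [Bivariate.swap_monomial_monomial]
      simp only [coeff_monomial]
      split_ifs <;> simp_all [coeff_monomial]

theorem natDegree_coeff_le_natDegree_swap (p : R[X][X]) (i : ℕ) :
    (p.coeff i).natDegree ≤ (Bivariate.swap p).natDegree := by
  rw [natDegree_le_iff_coeff_eq_zero]
  intro j hj
  rw [← coeff_coeff_swap, coeff_eq_zero_of_natDegree_lt hj, coeff_zero]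

theorem natDegree_swap_le {p : R[X][X]} {N : ℕ} (h : ∀ i, (p.coeff i).natDegree ≤ N) :
    (Bivariate.swap p).natDegree ≤ N := by
  rw [natDegree_le_iff_coeff_eq_zero]
  intro j hj
  ext i
  rw [coeff_coeff_swap, coeff_eq_zero_of_natDegree_lt ((h i).trans_lt hj), coeff_zero]

end InnerDerivative

/-- The homogenization of `M` in degree `N`, evaluated at `(W, V)`. -/
noncomputable def homEval {R : Type*} [CommRing R] (M : R[X][X]) (N : ℕ) (W V : R[X][X]) :
    R[X][X] :=
  ∑ i ∈ Finset.range (N + 1), C (M.coeff i) * (W ^ i * V ^ (N - i))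

theorem map_homEval {R S : Type*} [CommRing R] [CommRing S] (θ : R[X][X] →+* S) {M : R[X][X]}
    {N : ℕ} (hN : M.natDegree ≤ N) {W V : R[X][X]} {u : S} (hu : θ W = u * θ V) :
    θ (homEval M N W V) = θ V ^ N * M.eval₂ (θ.comp C) u := by
  rw [homEval, map_sum, eval₂_eq_sum_range' _ (Nat.lt_succ_of_le hN), Finset.mul_sum]
  refine Finset.sum_congr rfl fun i hi => ?_
  have : i ≤ N := by simpa [Nat.lt_succ_iff] using hi
  obtain ⟨k, rfl⟩ := Nat.exists_eq_add_of_le this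
  simp only [map_mul, map_pow, hu, RingHom.comp_apply, Nat.add_sub_cancel_left]
  ring

/-- The derivation `p ↦ p_t F_x - p_x F_t`, tangent to the curve `F = 0`. -/
noncomputable def tangentDerivative {R : Type*} [CommRing R] (F p : R[X][X]) : R[X][X] :=
  innerDerivative p * derivative F - derivative p * innerDerivative F

section Tangent

variable {R : Type*} [CommRing R] {F : R[X][X]}

theorem tangentDerivative_mul (p q : R[X][X]) : tangentDerivative F (p * q) =
    tangentDerivative F p * q + p * tangentDerivative F q := by
  simp only [tangentDerivative, innerDerivative_mul, derivative_mul]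
  ring

theorem tangentDerivative_sum {ι : Type*} (s : Finset ι) (f : ι → R[X][X]) :
    tangentDerivative F (∑ i ∈ s, f i) = ∑ i ∈ s, tangentDerivative F (f i) := by
  simp only [tangentDerivative, innerDerivative_sum, derivative_sum, Finset.sum_mul,
    Finset.sum_sub_distrib]

theorem tangentDerivative_C (a : R[X]) :
    tangentDerivative F (C a) = C (derivative a) * derivative F := by
  simp only [tangentDerivative, innerDerivative_C, derivative_C, zero_mul, sub_zero]

theorem dvd_tangentDerivative {p : R[X][X]} (h : F ∣ p) : F ∣ tangentDerivative F p := by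
  obtain ⟨q, rfl⟩ := h
  rw [tangentDerivative_mul]
  refine dvd_add (Dvd.dvd.mul_right ?_ _) (dvd_mul_right _ _)
  simp [tangentDerivative, mul_comm]

theorem map_tangentDerivative_pow_mul_pow {E : Type*} [CommRing E] (π : R[X][X] →+* E)
    {κ : E} {W V : R[X][X]} (hW : π (tangentDerivative F W) = κ * π W)
    (hV : π (tangentDerivative F V) = κ * π V) (i j : ℕ) :
    π (tangentDerivative F (W ^ i * V ^ j)) = (i + j : ℕ) * κ * π (W ^ i * V ^ j) := by
  have key (U : R[X][X]) (hU : π (tangentDerivative F U) = κ * π U) (i : ℕ) :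
      π (tangentDerivative F (U ^ i)) = i * κ * π (U ^ i) := by
    induction i with
    | zero => simpa using congrArg π (tangentDerivative_C (F := F) 1)
    | succ i ih =>
      rw [pow_succ, tangentDerivative_mul, map_add, map_mul, map_mul, ih, hU, map_mul]
      push_cast
      ring
  rw [tangentDerivative_mul, map_add, map_mul, map_mul, key W hW, key V hV, map_mul]
  push_cast
  ring

/-- The logarithmic closedness operator `F (p_t - q_x) - p F_t + q F_x` of Ruppert and Gao. -/
noncomputable def ruppert (F p q : R[X][X]) : R[X][X] :=
  F * (innerDerivative p - derivative q) - p * innerDerivative F + q * derivative F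

theorem ruppert_map {S : Type*} [CommRing S] (φ : R →+* S) (F p q : R[X][X]) :
    ruppert (F.map (mapRingHom φ)) (p.map (mapRingHom φ)) (q.map (mapRingHom φ)) =
      (ruppert F p q).map (mapRingHom φ) := by
  simp only [ruppert, innerDerivative_map, derivative_map, Polynomial.map_add, Polynomial.map_sub,
    Polynomial.map_mul]

theorem ruppert_mul (p q : R[X][X]) :
    ruppert (p * q) (derivative p * q) (innerDerivative p * q) = 0 := by
  simp only [ruppert, innerDerivative_mul, derivative_mul, innerDerivative_derivative]
  ring

/-- A solution of Ruppert's equation is, divided by `F_x`, constant on the curve `F = 0`. -/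
theorem dvd_of_ruppert_eq_zero {W H : R[X][X]} (h : ruppert F W H = 0) :
    F ∣ derivative F * (derivative F * tangentDerivative F W -
      W * tangentDerivative F (derivative F)) := by
  have h' := congrArg derivative h
  simp only [ruppert, derivative_add, derivative_sub, derivative_mul, derivative_zero] at h h'
  simp only [tangentDerivative, innerDerivative_derivative]
  set Fx := derivative F
  set Ft := innerDerivative F
  set Wt := innerDerivative W
  set Wx := derivative W
  set Hx := derivative H
  refine ⟨-(Fx * Fx * derivative (Wt - Hx)) + (derivative Fx) * Fx * (Wt - Hx), ?_⟩
  rw [derivative_sub]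
  linear_combination (Fx ^ 2) * h' - (derivative Fx * Fx) * h

theorem eval₂_innerDerivative_eq_zero {E : Type*} [Field E] (π : R[X][X] →+* E)
    (hπ : ∀ p, π p = 0 ↔ F ∣ p) (hF : π (derivative F) ≠ 0) {W H : R[X][X]}
    (h : ruppert F W H = 0) {M : R[X][X]}
    (hM : M.eval₂ (π.comp C) (π W / π (derivative F)) = 0) :
    (innerDerivative M).eval₂ (π.comp C) (π W / π (derivative F)) = 0 := by
  set V := derivative F with hV
  set u := π W / π V with hu
  have huW : π W = u * π V := by rw [hu, div_mul_cancel₀ _ hF]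
  set κ := π (tangentDerivative F V) / π V with hκ
  have hVκ : π (tangentDerivative F V) = κ * π V := by rw [hκ, div_mul_cancel₀ _ hF]
  have hWκ : π (tangentDerivative F W) = κ * π W := by
    have h1 := (hπ _).2 (dvd_of_ruppert_eq_zero h)
    rw [map_mul, map_sub, map_mul, map_mul, ← hV, hVκ] at h1
    have h2 := (mul_eq_zero.1 h1).resolve_left hF
    apply mul_left_cancel₀ hF
    linear_combination h2
  set N := M.natDegree
  have hN : (innerDerivative M).natDegree ≤ N := by
    rw [natDegree_le_iff_coeff_eq_zero]
    intro j hj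
    rw [coeff_innerDerivative, coeff_eq_zero_of_natDegree_lt hj, derivative_zero]
  have h0 : π (homEval M N W V) = 0 := by
    rw [map_homEval π le_rfl huW, hM, mul_zero]
  have h1 := (hπ _).2 (dvd_tangentDerivative ((hπ _).1 h0))
  have h2 : π (tangentDerivative F (homEval M N W V)) =
      π V * π (homEval (innerDerivative M) N W V) + N * κ * π (homEval M N W V) := by
    simp only [homEval, tangentDerivative_sum, map_sum, Finset.mul_sum, ← Finset.sum_add_distrib]
    refine Finset.sum_congr rfl fun i hi => ?_
    have : i ≤ N := by simpa [Nat.lt_succ_iff] using hi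
    rw [tangentDerivative_mul, tangentDerivative_C, map_add, map_mul, map_mul, map_mul _ (C _),
      map_tangentDerivative_pow_mul_pow π hWκ hVκ, coeff_innerDerivative, map_mul _ (C _),
      map_mul _ (C _), Nat.add_sub_cancel' this]
    ring
  rw [h1, h0, mul_zero, add_zero, map_homEval π hN huW] at h2
  exact (mul_eq_zero.1 ((mul_eq_zero.1 h2.symm).resolve_left hF)).resolve_left (pow_ne_zero _ hF)

end Tangent

section Constants

variable {R : Type} [CommRing R]

theorem exists_field_aeval_eq_zero_iff {F : R[X][X]} (hF : Prime F) :
    ∃ (E : Type) (_ : Field E) (_ : Algebra R[X] E) (x : E), ∀ p, aeval x p = 0 ↔ F ∣ p := by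
  have : IsDomain (AdjoinRoot F) := AdjoinRoot.isDomain_of_prime hF
  refine ⟨FractionRing (AdjoinRoot F), inferInstance, inferInstance,
    algebraMap (AdjoinRoot F) _ (AdjoinRoot.root F), fun p => ?_⟩
  rw [aeval_algebraMap_apply, AdjoinRoot.aeval_eq, FaithfulSMul.algebraMap_eq_zero_iff,
    AdjoinRoot.mk_eq_zero]

variable [IsDomain R]

theorem exists_map_C_eval₂_eq_zero [CharZero R] {E : Type*} [CommRing E] (φ : R[X] →+* E) (u : E)
    (hder : ∀ M : R[X][X], M.eval₂ φ u = 0 → (innerDerivative M).eval₂ φ u = 0) {M : R[X][X]}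
    (hM0 : M ≠ 0) (hM : M.eval₂ φ u = 0) :
    ∃ N : R[X], N ≠ 0 ∧ (N.map C).eval₂ φ u = 0 := by
  induction hn : (Bivariate.swap M).natDegree using Nat.strong_induction_on generalizing M with
  | _ n ih =>
    by_cases h0 : (Bivariate.swap M).natDegree = 0
    · have h1 : M = ((Bivariate.swap M).coeff 0).map C := by
        rw [← Bivariate.swap_C, ← eq_C_of_natDegree_eq_zero h0, Bivariate.swap_swap_apply]
      refine ⟨(Bivariate.swap M).coeff 0, fun h => hM0 ?_, h1 ▸ hM⟩
      rw [h1, h, Polynomial.map_zero]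
    · refine ih _ (hn ▸ ?_) (fun h => h0 (derivative_eq_zero.1 ?_)) (hder M hM) rfl
      · rw [← swap_innerDerivative, h, map_zero]
      · rw [swap_innerDerivative]
        exact natDegree_derivative_lt h0

theorem exists_eval₂_eq_zero_of_ruppert_eq_zero [CharZero R] {F : R[X][X]} (hmonic : F.Monic)
    (hF : Prime F) {E : Type} [Field E] [Algebra R[X] E] {x : E}
    (hx : ∀ p, aeval x p = 0 ↔ F ∣ p) {W H : R[X][X]} (h : ruppert F W H = 0) :
    aeval x (derivative F) ≠ 0 ∧ ∃ N : R[X], N ≠ 0 ∧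
      (N.map C).eval₂ (algebraMap R[X] E) (aeval x W / aeval x (derivative F)) = 0 := by
  have hinj : Function.Injective (algebraMap R[X] E) := by
    rw [injective_iff_map_eq_zero]
    intro a ha
    have h1 : F ∣ C a := by rw [← hx, aeval_C, ha]
    by_contra h0
    have := natDegree_le_of_dvd h1 (C_ne_zero.2 h0)
    rw [natDegree_C, Nat.le_zero] at this
    exact hF.not_isUnit (hmonic.natDegree_eq_zero.1 this ▸ isUnit_one)
  have hd : F.natDegree ≠ 0 := fun h0 =>
    hF.not_isUnit (hmonic.natDegree_eq_zero.1 h0 ▸ isUnit_one)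
  have hFx : aeval x (derivative F) ≠ 0 := by
    rw [Ne, hx]
    intro hdvd
    have h0 : derivative F ≠ 0 := fun h0 => hd (derivative_eq_zero.1 h0)
    exact absurd (natDegree_le_of_dvd hdvd h0) (not_le.2 (natDegree_derivative_lt hd))
  have hcomp : ((aeval x : R[X][X] →ₐ[R[X]] E) : R[X][X] →+* E).comp C = algebraMap R[X] E := by
    ext <;> simp
  refine ⟨hFx, ?_⟩
  have hxint : IsIntegral R[X] x := ⟨F, hmonic, (hx F).2 dvd_rfl⟩
  have hint (p : R[X][X]) : IsAlgebraic R[X] (aeval x p) := by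
    have : FaithfulSMul R[X] E := (faithfulSMul_iff_algebraMap_injective _ _).2 hinj
    exact IsIntegral.isAlgebraic
      (adjoin_le_integralClosure hxint (aeval_mem_adjoin_singleton R[X] x (p := p)))
  have halg : IsAlgebraic R[X] (aeval x W / aeval x (derivative F)) := by
    rw [div_eq_mul_inv]
    exact (hint _).mul (hint _).inv
  obtain ⟨M, hM0, hM⟩ := halg
  refine exists_map_C_eval₂_eq_zero _ _ (fun M hM => ?_) hM0 hM
  rw [← hcomp] at hM ⊢
  exact eval₂_innerDerivative_eq_zero (aeval x : R[X][X] →ₐ[R[X]] E).toRingHom hx hFx h hM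

/-- On an irreducible curve, a solution of Ruppert's equation satisfies an algebraic equation with
constant coefficients, which may be taken to be the minimal polynomial of any of its values. -/
theorem aeval_minpoly_eq_zero_of_ruppert_eq_zero [CharZero R] [IsIntegrallyClosed R]
    {F : R[X][X]} (hmonic : F.Monic) (hF : Prime F) {W H : R[X][X]} (h : ruppert F W H = 0)
    {S : Type} [CommRing S] [IsDomain S] [Algebra R S] [Module.IsTorsionFree R S]
    {θ₁ θ₂ : R[X][X] →+* S}
    (hθ₁ : ∀ r, θ₁ (C (C r)) = algebraMap R S r) (hθ₂ : ∀ r, θ₂ (C (C r)) = algebraMap R S r)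
    (hF₁ : θ₁ F = 0) (hF₂ : θ₂ F = 0) (hd₁ : θ₁ (derivative F) ≠ 0) (hd₂ : θ₂ (derivative F) ≠ 0)
    {v₁ v₂ : S} (hv₁ : θ₁ W = v₁ * θ₁ (derivative F)) (hv₂ : θ₂ W = v₂ * θ₂ (derivative F))
    (hint : IsIntegral R v₁) : aeval v₂ (minpoly R v₁) = 0 := by
  classical
  obtain ⟨E, _, _, x, hx⟩ := exists_field_aeval_eq_zero_iff hF
  obtain ⟨hd, hN⟩ := exists_eval₂_eq_zero_of_ruppert_eq_zero hmonic hF hx h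
  set u := aeval x W / aeval x (derivative F) with hu
  have huW : aeval x W = u * aeval x (derivative F) := by rw [hu, div_mul_cancel₀ _ hd]
  have hcomp : ((aeval x : R[X][X] →ₐ[R[X]] E) : R[X][X] →+* E).comp C = algebraMap R[X] E := by
    ext <;> simp
  have transfer {θ : R[X][X] →+* S} (hθ : ∀ r, θ (C (C r)) = algebraMap R S r) (hFθ : θ F = 0)
      (hdθ : θ (derivative F) ≠ 0) {v : S} (hv : θ W = v * θ (derivative F)) {N : R[X]}
      (hN : (N.map C).eval₂ (algebraMap R[X] E) u = 0) : aeval v N = 0 := by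
    have h1 := map_homEval (aeval x : R[X][X] →ₐ[R[X]] E).toRingHom
      (le_refl (N.map C).natDegree) huW
    have h2 := map_homEval θ (le_refl (N.map C).natDegree) hv
    have h3 : F ∣ homEval (N.map C) (N.map C).natDegree W (derivative F) := by
      rw [← hx]
      refine h1.trans ?_
      rw [AlgHom.toRingHom_eq_coe, hcomp, hN, mul_zero]
    obtain ⟨q, hq⟩ := h3
    rw [hq, map_mul, hFθ, zero_mul, eval₂_map] at h2
    have h4 := (mul_eq_zero.1 h2.symm).resolve_left (pow_ne_zero _ hdθ)
    have h5 : (θ.comp C).comp C = algebraMap R S := RingHom.ext hθ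
    rwa [h5] at h4
  have hex : ∃ n, ∃ N : R[X], N.natDegree = n ∧ N ≠ 0 ∧
      (N.map C).eval₂ (algebraMap R[X] E) u = 0 := by
    obtain ⟨N, h0, h1⟩ := hN
    exact ⟨_, N, rfl, h0, h1⟩
  obtain ⟨N, hNd, hN0, hNu⟩ := Nat.find_spec hex
  obtain ⟨N', hN'⟩ := minpoly.isIntegrallyClosed_dvd hint (transfer hθ₁ hF₁ hd₁ hv₁ hNu)
  have hN'0 : N' ≠ 0 := by
    rintro rfl
    exact hN0 (by rw [hN', mul_zero])
  rw [hN', Polynomial.map_mul, eval₂_mul] at hNu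
  rcases mul_eq_zero.1 hNu with h1 | h1
  · exact transfer hθ₂ hF₂ hd₂ hv₂ h1
  · exfalso
    refine Nat.find_min hex (m := N'.natDegree) ?_ ⟨N', rfl, hN'0, h1⟩
    rw [← hNd, hN', natDegree_mul (minpoly.ne_zero hint) hN'0]
    have := minpoly.natDegree_pos hint
    lia

end Constants

section Specialization

variable {σ K L : Type} [Field K] [Field L] [Algebra K L]

attribute [local instance] MvPolynomial.algebraMvPolynomial

theorem MvPolynomial.algebraMap_C (a : K) :
    algebraMap (MvPolynomial σ K) (MvPolynomial σ L) (MvPolynomial.C a) =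
      MvPolynomial.C (algebraMap K L a) := by
  rw [MvPolynomial.algebraMap_def, MvPolynomial.map_C]

theorem MvPolynomial.algebraMap_X (i : σ) :
    algebraMap (MvPolynomial σ K) (MvPolynomial σ L) (MvPolynomial.X i) = MvPolynomial.X i := by
  rw [MvPolynomial.algebraMap_def, MvPolynomial.map_X]

theorem MvPolynomial.sub_C_eval_mem_map_ker (β : σ → K) (p : MvPolynomial σ L) :
    p - MvPolynomial.C (MvPolynomial.eval (fun i => algebraMap K L (β i)) p) ∈
      (RingHom.ker (MvPolynomial.eval β)).map
        (algebraMap (MvPolynomial σ K) (MvPolynomial σ L)) := by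
  induction p using MvPolynomial.induction_on with
  | C a => simp
  | add p q hp hq =>
    rw [map_add, map_add, add_sub_add_comm]
    exact add_mem hp hq
  | mul_X p i hp =>
    rw [map_mul, MvPolynomial.eval_X, map_mul]
    have h1 : (MvPolynomial.X i - MvPolynomial.C (algebraMap K L (β i)) : MvPolynomial σ L) ∈
        (RingHom.ker (MvPolynomial.eval β)).map
          (algebraMap (MvPolynomial σ K) (MvPolynomial σ L)) := by
      have h2 : (MvPolynomial.X i - MvPolynomial.C (β i) : MvPolynomial σ K) ∈
          RingHom.ker (MvPolynomial.eval β) := by simp [RingHom.mem_ker]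
      have h3 := Ideal.mem_map_of_mem (algebraMap _ (MvPolynomial σ L)) h2
      rwa [map_sub, MvPolynomial.algebraMap_X, MvPolynomial.algebraMap_C] at h3
    have h3 := add_mem (Ideal.mul_mem_left _ p h1)
      (Ideal.mul_mem_left _ (MvPolynomial.C (algebraMap K L (β i))) hp)
    convert h3 using 1
    ring

theorem eq_zero_of_aeval_minpoly_eq_zero [Algebra.IsAlgebraic K L] (β : σ → K)
    {v₁ v₂ : MvPolynomial σ L} (h : aeval v₂ (minpoly (MvPolynomial σ K) v₁) = 0) {c : K}
    (h₁ : MvPolynomial.eval (fun i => algebraMap K L (β i)) v₁ = algebraMap K L c)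
    (h₂ : MvPolynomial.eval (fun i => algebraMap K L (β i)) v₂ = 0) : c = 0 := by
  have : Algebra.IsIntegral K L := inferInstance
  have hmem := MvPolynomial.sub_C_eval_mem_map_ker β v₁
  rw [h₁] at hmem
  obtain ⟨Q, hQm, hQ0, hQ⟩ := exists_monic_aeval_eq_zero_forall_mem_of_mem_map hmem
  have hC : (MvPolynomial.C (algebraMap K L c) : MvPolynomial σ L) =
      algebraMap (MvPolynomial σ K) (MvPolynomial σ L) (MvPolynomial.C c) :=
    (MvPolynomial.algebraMap_C c).symm
  have hdvd : minpoly (MvPolynomial σ K) v₁ ∣ Q.comp (X - C (MvPolynomial.C c)) := by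
    apply minpoly.isIntegrallyClosed_dvd (Algebra.IsIntegral.isIntegral _)
    rw [aeval_comp, map_sub, aeval_X, aeval_C, ← hC, hQ0]
  have hv₂ : aeval (v₂ - MvPolynomial.C (algebraMap K L c)) Q = 0 := by
    obtain ⟨T, hT⟩ := hdvd
    have := congrArg (aeval v₂) hT
    rwa [map_mul, h, zero_mul, aeval_comp, map_sub, aeval_X, aeval_C, ← hC] at this
  have hcomp : (MvPolynomial.eval (fun i => algebraMap K L (β i))).comp
      (algebraMap (MvPolynomial σ K) (MvPolynomial σ L)) =
      (algebraMap K L).comp (MvPolynomial.eval β) := by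
    refine MvPolynomial.ringHom_ext (fun a => ?_) (fun i => ?_)
    · rw [RingHom.comp_apply, RingHom.comp_apply, MvPolynomial.algebraMap_C, MvPolynomial.eval_C,
        MvPolynomial.eval_C]
    · rw [RingHom.comp_apply, RingHom.comp_apply, MvPolynomial.algebraMap_X, MvPolynomial.eval_X,
        MvPolynomial.eval_X]
  have hQβ : Q.map (MvPolynomial.eval β) = X ^ Q.natDegree := by
    ext i
    rw [coeff_map, coeff_X_pow]
    split_ifs with hi
    · rw [hi, hQm.coeff_natDegree, map_one]
    · exact hQ i hi
  have := congrArg (MvPolynomial.eval (fun i => algebraMap K L (β i))) hv₂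
  rw [aeval_def, hom_eval₂, hcomp, ← eval₂_map, hQβ, eval₂_X_pow, map_sub, h₂,
    MvPolynomial.eval_C, map_zero, zero_sub] at this
  have := eq_zero_of_pow_eq_zero this
  simpa using this

end Specialization

/-- Substitution of the line `t ↦ b t + c`. -/
noncomputable def lineMap {σ A : Type} [CommRing A] [Algebra ℚ A] (b c : σ → A) :
    MvPolynomial σ ℚ →+* A[X] :=
  (MvPolynomial.aeval fun i => C (b i) * X + C (c i) : MvPolynomial σ ℚ →ₐ[ℚ] A[X])

section LineMap

variable {σ A B : Type} [CommRing A] [Algebra ℚ A] [CommRing B] [Algebra ℚ B]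

theorem lineMap_X (b c : σ → A) (i : σ) :
    lineMap b c (MvPolynomial.X i) = C (b i) * X + C (c i) :=
  MvPolynomial.aeval_X _ i

theorem mapRingHom_comp_lineMap (φ : A →+* B) (b c : σ → A) :
    (mapRingHom φ).comp (lineMap b c) = lineMap (fun i => φ (b i)) (fun i => φ (c i)) := by
  refine MvPolynomial.ringHom_ext' (Subsingleton.elim _ _) fun i => ?_
  simp [lineMap_X]

theorem evalRingHom_zero_comp_lineMap (b : σ → A) (c : σ → ℚ) :
    (evalRingHom 0).comp (lineMap b (fun i => algebraMap ℚ A (c i))) =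
      (algebraMap ℚ A).comp (MvPolynomial.eval c) := by
  refine MvPolynomial.ringHom_ext' (Subsingleton.elim _ _) fun i => ?_
  rw [RingHom.comp_apply, RingHom.comp_apply, lineMap_X, MvPolynomial.eval_X, coe_evalRingHom,
    eval_add, eval_mul, eval_X, mul_zero, zero_add, eval_C]

theorem irreducible_map_lineMap (c : σ → ℚ) {g : (MvPolynomial σ ℚ)[X]} (hg : Irreducible g)
    (hmonic : g.Monic) :
    Irreducible (g.map (lineMap (A := MvPolynomial σ ℚ) MvPolynomial.X
      (fun i => MvPolynomial.C (c i)))) := by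
  let φ : (MvPolynomial σ ℚ)[X] →+* MvPolynomial σ ℚ :=
    eval₂RingHom (MvPolynomial.aeval fun i =>
      MvPolynomial.X i - MvPolynomial.C (c i) : MvPolynomial σ ℚ →ₐ[ℚ] _) 1
  refine Monic.irreducible_of_irreducible_map φ _ (hmonic.map _) ?_
  rw [Polynomial.map_map]
  have : φ.comp (lineMap (A := MvPolynomial σ ℚ) MvPolynomial.X
      (fun i => MvPolynomial.C (c i))) = RingHom.id _ := by
    refine MvPolynomial.ringHom_ext' (Subsingleton.elim _ _) fun i => ?_
    simp [φ, lineMap_X]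
  rwa [this, Polynomial.map_id]

attribute [local instance] MvPolynomial.algebraMvPolynomial

/-- For an irreducible `g`, the Ruppert solution attached to a proper factor of a specialization
along a line through a separable point never lifts to all lines through that point. -/
theorem ruppert_ne_zero_of_factor {g : (MvPolynomial σ ℚ)[X]} (hg : Irreducible g)
    (hmonic : g.Monic) (β γ : σ → ℚ)
    (hsep : IsCoprime (g.map (MvPolynomial.eval γ)) (derivative (g.map (MvPolynomial.eval γ))))
    (Ω : Type) [Field Ω] [Algebra ℚ Ω] [IsAlgClosed Ω] [Algebra.IsAlgebraic ℚ Ω]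
    {h₁ h₂ : ℚ[X][X]} (hm₁ : h₁.Monic) (hm₂ : h₂.Monic) (hd₁ : h₁.natDegree ≠ 0)
    (hd₂ : h₂.natDegree ≠ 0) (hmul : h₁ * h₂ = g.map (lineMap β γ))
    {W H : (MvPolynomial σ ℚ)[X][X]} {c : ℚ} (hc : c ≠ 0)
    (hW : W.map (mapRingHom (MvPolynomial.eval β)) = C (C c) * (derivative h₁ * h₂)) :
    ruppert (g.map (lineMap MvPolynomial.X (fun i => MvPolynomial.C (γ i)))) W H ≠ 0 := by
  intro hrup
  set F := g.map (lineMap (A := MvPolynomial σ ℚ) MvPolynomial.X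
    (fun i => MvPolynomial.C (γ i))) with hF
  set f := g.map (MvPolynomial.eval γ) with hf
  have hFm : F.Monic := hmonic.map _
  have hFp : Prime F := (irreducible_map_lineMap γ hg hmonic).prime
  let θ (ξ : Ω) : (MvPolynomial σ ℚ)[X][X] →+* MvPolynomial σ Ω :=
    eval₂RingHom ((MvPolynomial.map (algebraMap ℚ Ω)).comp (evalRingHom 0)) (MvPolynomial.C ξ)
  have hθC (ξ : Ω) (r : MvPolynomial σ ℚ) :
      θ ξ (C (C r)) = algebraMap (MvPolynomial σ ℚ) (MvPolynomial σ Ω) r := by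
    simp only [θ, coe_eval₂RingHom, eval₂_C, RingHom.comp_apply, coe_evalRingHom, eval_C]
    rw [MvPolynomial.algebraMap_def]
  have hθg (ξ : Ω) (q : (MvPolynomial σ ℚ)[X]) :
      θ ξ (q.map (lineMap (A := MvPolynomial σ ℚ) MvPolynomial.X
        (fun i => MvPolynomial.C (γ i)))) =
      MvPolynomial.C (aeval ξ (q.map (MvPolynomial.eval γ))) := by
    have h := evalRingHom_zero_comp_lineMap (A := MvPolynomial σ ℚ) MvPolynomial.X γ
    rw [MvPolynomial.algebraMap_eq] at h
    simp only [θ, coe_eval₂RingHom, aeval_def]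
    rw [eval₂_map, RingHom.comp_assoc, h, eval₂_map, hom_eval₂]
    congr 1
    ext <;> simp
  have hθβ (ξ : Ω) (q : (MvPolynomial σ ℚ)[X][X]) :
      MvPolynomial.eval (fun i => algebraMap ℚ Ω (β i)) (θ ξ q) =
        aeval ξ ((q.map (mapRingHom (MvPolynomial.eval β))).map (evalRingHom 0)) := by
    simp only [θ, coe_eval₂RingHom, aeval_def]
    rw [hom_eval₂, MvPolynomial.eval_C, eval₂_map, eval₂_map]
    congr 1
    ext <;> simp
  set p₁ := h₁.map (evalRingHom 0) with hp₁
  set p₂ := h₂.map (evalRingHom 0) with hp₂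
  have hp : p₁ * p₂ = f := by
    have h := evalRingHom_zero_comp_lineMap (A := ℚ) β γ
    rw [Algebra.algebraMap_self, RingHom.id_comp] at h
    rw [hp₁, hp₂, ← Polynomial.map_mul, hmul, Polynomial.map_map, hf, ← h]
    rfl
  have root {p : ℚ[X][X]} (hm : p.Monic) (hd : p.natDegree ≠ 0) :
      ∃ ξ : Ω, aeval ξ (p.map (evalRingHom 0)) = 0 := by
    refine IsAlgClosed.exists_aeval_eq_zero Ω _ ?_
    rw [degree_eq_natDegree (hm.map _).ne_zero, hm.natDegree_map]
    exact_mod_cast hd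
  obtain ⟨ξ₁, hξ₁⟩ := root hm₁ hd₁
  obtain ⟨ξ₂, hξ₂⟩ := root hm₂ hd₂
  have hroot₁ : aeval ξ₁ f = 0 := by rw [← hp, map_mul, hξ₁, zero_mul]
  have hroot₂ : aeval ξ₂ f = 0 := by rw [← hp, map_mul, hξ₂, mul_zero]
  have hder {ξ : Ω} (h : aeval ξ f = 0) : aeval ξ (derivative f) ≠ 0 := by
    intro h0
    obtain ⟨u, v, huv⟩ := hsep
    have := congrArg (aeval ξ) huv
    rw [map_add, map_mul, map_mul, h, h0] at this
    simp at this
  have hθF' (ξ : Ω) : θ ξ (derivative F) = MvPolynomial.C (aeval ξ (derivative f)) := by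
    rw [hF, derivative_map, hθg, hf, derivative_map]
  let v (ξ : Ω) : MvPolynomial σ Ω := θ ξ W * MvPolynomial.C (aeval ξ (derivative f))⁻¹
  have hv {ξ : Ω} (h : aeval ξ f = 0) : θ ξ W = v ξ * θ ξ (derivative F) := by
    rw [hθF', mul_assoc, ← map_mul, inv_mul_cancel₀ (hder h), map_one, mul_one]
  have hvβ (ξ : Ω) : MvPolynomial.eval (fun i => algebraMap ℚ Ω (β i)) (v ξ) =
      algebraMap ℚ Ω c * (aeval ξ (derivative p₁) * aeval ξ p₂) *
        (aeval ξ (derivative f))⁻¹ := by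
    rw [map_mul, MvPolynomial.eval_C, hθβ, hW, Polynomial.map_mul, Polynomial.map_mul, map_mul,
      map_mul, hp₁, derivative_map h₁, Polynomial.map_C, aeval_C, coe_evalRingHom, eval_C]
  have : IsDomain (MvPolynomial σ Ω) := inferInstance
  have hfaith : Module.IsTorsionFree (MvPolynomial σ ℚ) (MvPolynomial σ Ω) := inferInstance
  have hmin := aeval_minpoly_eq_zero_of_ruppert_eq_zero hFm hFp hrup (θ₁ := θ ξ₁) (θ₂ := θ ξ₂)
    (hθC ξ₁)
    (hθC ξ₂)
    (by rw [hF, hθg, ← hf, hroot₁, map_zero]) (by rw [hF, hθg, ← hf, hroot₂, map_zero])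
    (by rw [hθF']; simpa using hder hroot₁) (by rw [hθF']; simpa using hder hroot₂)
    (hv hroot₁) (hv hroot₂) (Algebra.IsIntegral.isIntegral _)
  refine hc (eq_zero_of_aeval_minpoly_eq_zero β hmin ?_ ?_)
  · have h1 : aeval ξ₁ (derivative f) = aeval ξ₁ (derivative p₁) * aeval ξ₁ p₂ := by
      rw [← hp, derivative_mul, map_add, map_mul, map_mul, hξ₁, zero_mul, add_zero]
    rw [hvβ, ← h1, mul_assoc, mul_inv_cancel₀ (hder hroot₁), mul_one]
  · rw [hvβ, hξ₂, mul_zero, mul_zero, zero_mul]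

end LineMap

section Minors

open Matrix

variable {R : Type*} [CommRing R] [IsDomain R]

theorem Matrix.det_smul_eq_mul_adjugate_mul {m : Type*} [Fintype m] [DecidableEq m]
    {A : Matrix m m R} {B : Matrix m (Fin 1) R} {C : Matrix (Fin 1) m R}
    {D : Matrix (Fin 1) (Fin 1) R} (hA : A.det ≠ 0) (h : (fromBlocks A B C D).det = 0) :
    A.det • D = C * (A.adjugate * B) := by
  rw [← sub_eq_zero]
  have h1 : fromBlocks A B C D * fromBlocks 1 (-(A.adjugate * B)) 0 (A.det • 1) =
      fromBlocks A 0 C (A.det • D - C * (A.adjugate * B)) := by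
    rw [fromBlocks_multiply]
    congr 1
    · simp
    · rw [Matrix.mul_neg, ← Matrix.mul_assoc, mul_adjugate]
      simp
    · simp
    · rw [Matrix.mul_neg, Matrix.mul_smul, Matrix.mul_one]
      abel
  have h2 := congrArg det h1
  rw [det_mul, h, zero_mul, det_fromBlocks_zero₁₂] at h2
  have h3 := (mul_eq_zero.1 h2.symm).resolve_left hA
  ext i j
  rw [det_fin_one] at h3
  rwa [Subsingleton.elim i 0, Subsingleton.elim j 0]

/-- A nonzero maximal minor `Δ` of `A` allows one to lift `Δ` times an approximate kernel vector
to an exact kernel vector. -/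
theorem Matrix.exists_minor_forall_exists_lift {ρ ι : Type*} [Fintype ι] (A : Matrix ρ ι R) :
    ∃ k ≤ Fintype.card ι, ∃ (I : Fin k → ρ) (J : Fin k → ι), (A.submatrix I J).det ≠ 0 ∧
      ∀ e : ι → R, ∃ w : ι → R, A *ᵥ w = 0 ∧ ∀ {S : Type} [CommRing S] (φ : R →+* S),
        (∀ r, φ ((A *ᵥ e) r) = 0) → ∀ j, φ (w j) = φ (A.submatrix I J).det * φ (e j) := by
  classical
  let P (k : ℕ) : Prop := ∃ (I : Fin k → ρ) (J : Fin k → ι), (A.submatrix I J).det ≠ 0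
  have hP {k : ℕ} (h : P k) : k ≤ Fintype.card ι := by
    obtain ⟨I, J, h⟩ := h
    have hJ : Function.Injective J := fun a b hab => by
      by_contra hne
      exact h (det_zero_of_column_eq hne fun i => by rw [submatrix_apply, submatrix_apply, hab])
    simpa using Fintype.card_le_of_injective J hJ
  have h0 : P 0 := ⟨Fin.elim0, Fin.elim0, by simp⟩
  set k := Nat.findGreatest P (Fintype.card ι)
  have hk : P k := Nat.findGreatest_spec (Nat.zero_le _) h0
  have hk1 : ¬ P (k + 1) := fun h =>
    absurd (Nat.le_findGreatest (hP h) h) (Nat.not_succ_le_self _)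
  obtain ⟨I, J, hdet⟩ := hk
  refine ⟨k, hP ⟨I, J, hdet⟩, I, J, hdet, fun e => ?_⟩
  set M := A.submatrix I J
  have hrow (r : ρ) (j : ι) :
      M.det * A r j = ∑ a, A r (J a) * (M.adjugate *ᵥ fun b => A (I b) j) a := by
    have hz : (fromBlocks M (A.submatrix I fun _ : Fin 1 => j) (A.submatrix (fun _ : Fin 1 => r) J)
        (A.submatrix (fun _ : Fin 1 => r) fun _ : Fin 1 => j)).det = 0 := by
      by_contra hne
      refine hk1 ⟨Sum.elim I (fun _ => r) ∘ finSumFinEquiv.symm,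
        Sum.elim J (fun _ => j) ∘ finSumFinEquiv.symm, ?_⟩
      rw [← submatrix_submatrix, det_submatrix_equiv_self]
      convert hne using 2
      ext (a | a) (b | b) <;> rfl
    have h := congrFun (congrFun (det_smul_eq_mul_adjugate_mul hdet hz) 0) 0
    exact h
  refine ⟨M.det • e - ∑ a, Pi.single (J a) ((M.adjugate *ᵥ fun b => (A *ᵥ e) (I b)) a), ?_, ?_⟩
  · ext r
    rw [mulVec_sub, mulVec_smul, mulVec_sum, Pi.sub_apply, Pi.smul_apply, Finset.sum_apply,
      Pi.zero_apply, sub_eq_zero]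
    simp only [mulVec_single, Pi.smul_apply, smul_eq_mul, MulOpposite.smul_eq_mul_unop,
      MulOpposite.unop_op, col_apply]
    simp only [mulVec, dotProduct, Finset.mul_sum] at hrow ⊢
    simp only [← mul_assoc, hrow, Finset.sum_mul]
    rw [Finset.sum_comm]
    refine Finset.sum_congr rfl fun a _ => ?_
    rw [Finset.sum_comm]
  · intro S _ φ hφ j
    rw [Pi.sub_apply, map_sub, Pi.smul_apply, smul_eq_mul, map_mul, sub_eq_self, Finset.sum_apply,
      map_sum]
    refine Finset.sum_eq_zero fun a _ => ?_
    have : φ ((M.adjugate *ᵥ fun b => (A *ᵥ e) (I b)) a) = 0 := by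
      simp only [mulVec, dotProduct, map_sum, map_mul] at hφ ⊢
      simp [hφ]
    rw [Pi.single_apply]
    split_ifs
    · exact this
    · exact map_zero φ

end Minors

section TotalDegree

variable {σ τ : Type}

theorem MvPolynomial.totalDegree_det_le {R : Type*} [CommRing R] {k N : ℕ}
    {A : Matrix (Fin k) (Fin k) (MvPolynomial τ R)} (hA : ∀ i j, (A i j).totalDegree ≤ N) :
    A.det.totalDegree ≤ k * N := by
  rw [Matrix.det_apply]
  refine MvPolynomial.totalDegree_finsetSum_le fun s _ => ?_
  refine (MvPolynomial.totalDegree_smul_le _ _).trans ?_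
  refine (MvPolynomial.totalDegree_finsetProd _ _).trans ?_
  simpa using Finset.sum_le_card_nsmul Finset.univ _ N fun i _ => hA (s i) i

theorem totalDegree_coeff_mul_le {p q : (MvPolynomial τ ℚ)[X]} {M N : ℕ}
    (hp : ∀ j, (p.coeff j).totalDegree ≤ M) (hq : ∀ j, (q.coeff j).totalDegree ≤ N) (j : ℕ) :
    ((p * q).coeff j).totalDegree ≤ M + N := by
  rw [coeff_mul]
  exact MvPolynomial.totalDegree_finsetSum_le fun x _ =>
    (MvPolynomial.totalDegree_mul _ _).trans (add_le_add (hp _) (hq _))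

theorem totalDegree_coeff_pow_le {p : (MvPolynomial τ ℚ)[X]} {M : ℕ}
    (hp : ∀ j, (p.coeff j).totalDegree ≤ M) (k j : ℕ) :
    ((p ^ k).coeff j).totalDegree ≤ k * M := by
  induction k generalizing j with
  | zero =>
    rw [pow_zero, coeff_one]
    split_ifs <;> simp
  | succ k ih =>
    rw [pow_succ, Nat.succ_mul]
    exact totalDegree_coeff_mul_le ih hp j

theorem totalDegree_coeff_lineMap_le {b c : σ → MvPolynomial τ ℚ}
    (hb : ∀ i, (b i).totalDegree ≤ 1) (hc : ∀ i, (c i).totalDegree ≤ 1) (p : MvPolynomial σ ℚ)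
    (j : ℕ) : ((lineMap b c p).coeff j).totalDegree ≤ p.totalDegree := by
  have hlin (i : σ) (j : ℕ) :
      ((C (b i) * X + C (c i) : (MvPolynomial τ ℚ)[X]).coeff j).totalDegree ≤ 1 := by
    rw [coeff_add, coeff_C_mul, coeff_X, coeff_C]
    refine (MvPolynomial.totalDegree_add _ _).trans (max_le ?_ ?_)
    · split_ifs
      · simpa using hb i
      · simp
    · split_ifs
      · exact hc i
      · simp
  have hprod (s : Finset σ) (m : σ →₀ ℕ) (j : ℕ) :
      ((∏ i ∈ s, (C (b i) * X + C (c i) : (MvPolynomial τ ℚ)[X]) ^ m i).coeff j).totalDegree ≤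
        ∑ i ∈ s, m i := by
    classical
    induction s using Finset.induction_on generalizing j with
    | empty =>
      rw [Finset.prod_empty, coeff_one]
      split_ifs <;> simp
    | insert i s hi ih =>
      rw [Finset.prod_insert hi, Finset.sum_insert hi]
      refine totalDegree_coeff_mul_le (fun j => ?_) ih j
      simpa using totalDegree_coeff_pow_le (hlin i) (m i) j
  have hsum : lineMap b c p = ∑ m ∈ p.support, C (MvPolynomial.C (p.coeff m)) *
      ∏ i ∈ m.support, (C (b i) * X + C (c i)) ^ m i := by
    conv_lhs => rw [p.as_sum, map_sum]
    exact Finset.sum_congr rfl fun m _ => MvPolynomial.aeval_monomial _ _ _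
  rw [hsum, finsetSum_coeff]
  refine MvPolynomial.totalDegree_finsetSum_le fun m hm => ?_
  rw [coeff_C_mul]
  refine (MvPolynomial.totalDegree_mul _ _).trans ?_
  rw [MvPolynomial.totalDegree_C, zero_add]
  exact (hprod _ m j).trans (MvPolynomial.le_totalDegree hm)

/-- All coefficients of a bivariate polynomial have total degree at most `N`. -/
def CoeffTotalDegreeLE (N : ℕ) (p : (MvPolynomial τ ℚ)[X][X]) : Prop :=
  ∀ i j, ((p.coeff i).coeff j).totalDegree ≤ N

namespace CoeffTotalDegreeLE

variable {N : ℕ} {p q : (MvPolynomial τ ℚ)[X][X]}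

theorem add (hp : CoeffTotalDegreeLE N p) (hq : CoeffTotalDegreeLE N q) :
    CoeffTotalDegreeLE N (p + q) := fun i j => by
  rw [coeff_add, coeff_add]
  exact (MvPolynomial.totalDegree_add _ _).trans (max_le (hp i j) (hq i j))

theorem sub (hp : CoeffTotalDegreeLE N p) (hq : CoeffTotalDegreeLE N q) :
    CoeffTotalDegreeLE N (p - q) := fun i j => by
  rw [coeff_sub, coeff_sub]
  exact (MvPolynomial.totalDegree_sub _ _).trans (max_le (hp i j) (hq i j))

theorem mul_monomial (hp : CoeffTotalDegreeLE N p) (i j k : ℕ) :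
    CoeffTotalDegreeLE N (p * (C (C (k : MvPolynomial τ ℚ) * X ^ j) * X ^ i)) := fun a b => by
  rw [← mul_assoc, coeff_mul_X_pow']
  split_ifs
  · rw [coeff_mul_C, ← mul_assoc, coeff_mul_X_pow']
    split_ifs
    · rw [coeff_mul_C, ← map_natCast (MvPolynomial.C : ℚ →+* MvPolynomial τ ℚ)]
      refine (MvPolynomial.totalDegree_mul _ _).trans ?_
      rw [MvPolynomial.totalDegree_C, add_zero]
      exact hp _ _
    · simp
  · simp

theorem derivative (hp : CoeffTotalDegreeLE N p) : CoeffTotalDegreeLE N p.derivative :=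
  fun i j => by
  have h : ((p.derivative).coeff i).coeff j =
      (p.coeff (i + 1)).coeff j * MvPolynomial.C (i + 1 : ℚ) := by
    rw [coeff_derivative]
    have : ((i : (MvPolynomial τ ℚ)[X]) + 1) = C (MvPolynomial.C (i + 1 : ℚ)) := by simp
    rw [this, coeff_mul_C]
  rw [h]
  refine (MvPolynomial.totalDegree_mul _ _).trans ?_
  rw [MvPolynomial.totalDegree_C, add_zero]
  exact hp _ _

theorem innerDerivative (hp : CoeffTotalDegreeLE N p) :
    CoeffTotalDegreeLE N (innerDerivative p) := fun i j => by
  rw [coeff_innerDerivative, coeff_derivative]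
  have : ((j : MvPolynomial τ ℚ) + 1) = MvPolynomial.C (j + 1 : ℚ) := by simp
  rw [this]
  refine (MvPolynomial.totalDegree_mul _ _).trans ?_
  rw [MvPolynomial.totalDegree_C, add_zero]
  exact hp _ _

theorem ruppert_left {F : (MvPolynomial τ ℚ)[X][X]} (hF : CoeffTotalDegreeLE N F) (i j : ℕ) :
    CoeffTotalDegreeLE N (ruppert F (C (X ^ j) * X ^ i) 0) := by
  have h1 := hF.mul_monomial i (j - 1) j
  have h2 := hF.innerDerivative.mul_monomial i j 1
  convert h1.sub h2 using 1
  have hX : _root_.innerDerivative (X ^ i : (MvPolynomial τ ℚ)[X][X]) = 0 := by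
    ext k : 1
    rw [coeff_innerDerivative, coeff_X_pow]
    split_ifs <;> simp
  rw [ruppert, innerDerivative_mul, innerDerivative_C, hX, derivative_X_pow]
  simp
  ring

theorem ruppert_right {F : (MvPolynomial τ ℚ)[X][X]} (hF : CoeffTotalDegreeLE N F) (i j : ℕ) :
    CoeffTotalDegreeLE N (ruppert F 0 (C (X ^ j) * X ^ i)) := by
  have h1 := hF.mul_monomial (i - 1) j i
  have h2 := hF.derivative.mul_monomial i j 1
  convert h2.sub h1 using 1
  rw [ruppert, innerDerivative_zero, derivative_mul, derivative_C, derivative_X_pow]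
  simp
  ring

end CoeffTotalDegreeLE

end TotalDegree

section Lift

theorem ruppert_add_right {R : Type*} [CommRing R] (F p q : R[X][X]) :
    ruppert F p q = ruppert F p 0 + ruppert F 0 q := by
  simp only [ruppert, innerDerivative_zero, derivative_zero]
  ring

theorem ruppert_sum_left {R ι : Type*} [CommRing R] (F : R[X][X]) (s : Finset ι) (a : ι → R)
    (f : ι → R[X][X]) :
    ruppert F (∑ i ∈ s, C (C (a i)) * f i) 0 = ∑ i ∈ s, C (C (a i)) * ruppert F (f i) 0 := by
  simp only [ruppert, innerDerivative_sum, innerDerivative_mul, innerDerivative_C, derivative_C,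
    map_zero, zero_mul, sub_zero, zero_add, add_zero, Finset.mul_sum,
    Finset.sum_mul]
  rw [← Finset.sum_sub_distrib]
  exact Finset.sum_congr rfl fun i _ => by ring

theorem ruppert_sum_right {R ι : Type*} [CommRing R] (F : R[X][X]) (s : Finset ι) (a : ι → R)
    (f : ι → R[X][X]) :
    ruppert F 0 (∑ i ∈ s, C (C (a i)) * f i) = ∑ i ∈ s, C (C (a i)) * ruppert F 0 (f i) := by
  simp only [ruppert, innerDerivative_zero, derivative_sum, derivative_mul, derivative_C, zero_mul, sub_zero,
    zero_add, zero_sub, Finset.sum_mul]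
  rw [← Finset.sum_neg_distrib, Finset.mul_sum, ← Finset.sum_add_distrib]
  exact Finset.sum_congr rfl fun i _ => by ring

/-- The bivariate polynomial with a given rectangle of coefficients. -/
noncomputable def ofCoeffs {R : Type*} [CommRing R] {d e : ℕ} (v : Fin d × Fin e → R) : R[X][X] :=
  ∑ k, C (C (v k)) * (C (X ^ (k.2 : ℕ)) * X ^ (k.1 : ℕ))

theorem map_ofCoeffs {R S : Type*} [CommRing R] [CommRing S] (φ : R →+* S) {d e : ℕ}
    (v : Fin d × Fin e → R) :
    (ofCoeffs v).map (mapRingHom φ) = ofCoeffs fun k => φ (v k) := by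
  simp [ofCoeffs, Polynomial.map_sum]

theorem ofCoeffs_coeff {R : Type*} [CommRing R] {d e : ℕ} {p : R[X][X]} (hd : p.natDegree < d)
    (he : ∀ i, (p.coeff i).natDegree < e) :
    ofCoeffs (fun k : Fin d × Fin e => (p.coeff k.1).coeff k.2) = p := by
  conv_rhs => rw [p.as_sum_range_C_mul_X_pow' hd, Finset.sum_range]
  rw [ofCoeffs, Fintype.sum_prod_type]
  refine Finset.sum_congr rfl fun i _ => ?_
  conv_rhs => rw [(p.coeff i).as_sum_range_C_mul_X_pow' (he i), Finset.sum_range, map_sum,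
    Finset.sum_mul]
  refine Finset.sum_congr rfl fun j _ => ?_
  rw [C_mul, mul_assoc]

theorem ofCoeffs_const_mul {R : Type*} [CommRing R] {d e : ℕ} (a : R) (v : Fin d × Fin e → R) :
    ofCoeffs (fun k => a * v k) = C (C a) * ofCoeffs v := by
  simp only [ofCoeffs, Finset.mul_sum, C_mul, mul_assoc]

/-- There is a polynomial `Δ` of controlled degree in the parameters such that `Δ` times any
solution of a specialization of Ruppert's equation lifts to a generic solution. -/
theorem exists_forall_exists_ruppert_lift {τ : Type} {N : ℕ} (d e : ℕ)
    {F : (MvPolynomial τ ℚ)[X][X]} (hF : CoeffTotalDegreeLE N F) :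
    ∃ Δ : MvPolynomial τ ℚ, Δ ≠ 0 ∧ Δ.totalDegree ≤ (d * e + d * e) * N ∧
      ∀ p q : (MvPolynomial τ ℚ)[X][X], p.natDegree < d → q.natDegree < d →
        (∀ i, (p.coeff i).natDegree < e) → (∀ i, (q.coeff i).natDegree < e) →
        ∃ W H : (MvPolynomial τ ℚ)[X][X], ruppert F W H = 0 ∧
          ∀ {S : Type} [CommRing S] (φ : MvPolynomial τ ℚ →+* S),
            (ruppert F p q).map (mapRingHom φ) = 0 →
            W.map (mapRingHom φ) = C (C (φ Δ)) * p.map (mapRingHom φ) := by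
  let A : Matrix (ℕ × ℕ) ((Fin d × Fin e) ⊕ (Fin d × Fin e)) (MvPolynomial τ ℚ) :=
    Matrix.of fun r c => ((c.elim (fun k => ruppert F (C (X ^ (k.2 : ℕ)) * X ^ (k.1 : ℕ)) 0)
      (fun k => ruppert F 0 (C (X ^ (k.2 : ℕ)) * X ^ (k.1 : ℕ)))).coeff r.1).coeff r.2
  have hA (r : ℕ × ℕ) (c) : (A r c).totalDegree ≤ N := by
    rcases c with k | k
    · exact hF.ruppert_left _ _ _ _
    · exact hF.ruppert_right _ _ _ _
  have hmul (v : (Fin d × Fin e) ⊕ (Fin d × Fin e) → MvPolynomial τ ℚ) (r : ℕ × ℕ) :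
      (A.mulVec v) r = ((ruppert F (ofCoeffs fun k => v (Sum.inl k))
        (ofCoeffs fun k => v (Sum.inr k))).coeff r.1).coeff r.2 := by
    rw [ruppert_add_right, ofCoeffs, ofCoeffs, ruppert_sum_left, ruppert_sum_right, coeff_add,
      coeff_add, finsetSum_coeff, finsetSum_coeff, finsetSum_coeff, finsetSum_coeff,
      Matrix.mulVec, dotProduct, Fintype.sum_sum_type]
    simp only [coeff_C_mul, A, Matrix.of_apply, Sum.elim_inl, Sum.elim_inr, mul_comm (v _)]
  obtain ⟨k, hk, I, J, hdet, hlift⟩ := A.exists_minor_forall_exists_lift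
  refine ⟨_, hdet, ?_, fun p q hpd hqd hpe hqe => ?_⟩
  · refine (MvPolynomial.totalDegree_det_le fun i j => hA (I i) (J j)).trans ?_
    refine Nat.mul_le_mul_right N (hk.trans_eq ?_)
    simp
  · obtain ⟨w, hw, hφ⟩ := hlift (Sum.elim (fun k => (p.coeff k.1).coeff k.2)
      (fun k => (q.coeff k.1).coeff k.2))
    refine ⟨ofCoeffs fun k => w (Sum.inl k), ofCoeffs fun k => w (Sum.inr k), ?_, ?_⟩
    · ext i j : 2
      rw [← hmul w (i, j), hw]
      rfl
    · intro S _ φ h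
      have h1 := hφ φ fun r => by
        rw [hmul]
        simp only [Sum.elim_inl, Sum.elim_inr]
        rw [ofCoeffs_coeff hpd hpe, ofCoeffs_coeff hqd hqe]
        have := congrArg (fun f => (f.coeff r.1).coeff r.2) h
        simpa only [coeff_map, coe_mapRingHom, coeff_zero] using this
      conv_rhs => rw [← ofCoeffs_coeff hpd hpe, map_ofCoeffs, ← ofCoeffs_const_mul]
      rw [map_ofCoeffs]
      congr 1
      funext k
      exact h1 (Sum.inl k)

end Lift

section Separability

theorem exists_isCoprime_derivative_of_eval_ne_zero {σ : Type} {N : ℕ}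
    {f : (MvPolynomial σ ℚ)[X]} (hf : Irreducible f) (hmonic : f.Monic)
    (hN : ∀ i, (f.coeff i).totalDegree ≤ N) :
    ∃ D : MvPolynomial σ ℚ, D ≠ 0 ∧ D.totalDegree ≤ (f.natDegree + f.natDegree) * N ∧
      ∀ γ : σ → ℚ, MvPolynomial.eval γ D ≠ 0 →
        IsCoprime (f.map (MvPolynomial.eval γ)) (derivative (f.map (MvPolynomial.eval γ))) := by
  have hd : f.natDegree ≠ 0 := fun h0 =>
    hf.not_isUnit (hmonic.natDegree_eq_zero.1 h0 ▸ isUnit_one)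
  refine ⟨resultant f (derivative f), ?_, ?_, fun γ hγ => ?_⟩
  · let K := FractionRing (MvPolynomial σ ℚ)
    have hinj : Function.Injective (algebraMap (MvPolynomial σ ℚ) K) :=
      IsFractionRing.injective _ _
    have hirr : Irreducible (f.map (algebraMap (MvPolynomial σ ℚ) K)) :=
      (hmonic.irreducible_iff_irreducible_map_fraction_map).1 hf
    have hcop : IsCoprime (f.map (algebraMap (MvPolynomial σ ℚ) K))
        ((derivative f).map (algebraMap (MvPolynomial σ ℚ) K)) := by
      rw [← derivative_map]
      exact hirr.separable
    have h := resultant_ne_zero _ _ hcop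
    rw [natDegree_map_eq_of_injective hinj, natDegree_map_eq_of_injective hinj,
      resultant_map_map] at h
    exact fun h0 => h (by rw [h0, map_zero])
  · refine (MvPolynomial.totalDegree_det_le (N := N) fun i j => ?_).trans
      (Nat.mul_le_mul_right N (Nat.add_le_add_left
        ((natDegree_derivative_le f).trans (Nat.sub_le _ _)) _))
    rw [sylvester, Matrix.of_apply]
    induction j using Fin.addCases with
    | left j =>
      rw [Fin.addCases_left]
      split_ifs
      · rw [coeff_derivative]
        generalize (i : ℕ) - (j : ℕ) = k
        have : ((k : MvPolynomial σ ℚ) + 1) = MvPolynomial.C (k + 1 : ℚ) := by simp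
        rw [this]
        refine (MvPolynomial.totalDegree_mul _ _).trans ?_
        rw [MvPolynomial.totalDegree_C, add_zero]
        exact hN _
      · simp
    | right j =>
      rw [Fin.addCases_right]
      split_ifs
      · exact hN _
      · simp
  · obtain ⟨p, q, -, -, h⟩ := exists_mul_add_mul_eq_C_resultant f (derivative f) le_rfl le_rfl
      (Or.inl hd)
    have h1 := congrArg (Polynomial.map (MvPolynomial.eval γ)) h
    rw [Polynomial.map_add, Polynomial.map_mul, Polynomial.map_mul, Polynomial.map_C,
      ← derivative_map] at h1
    set a := MvPolynomial.eval γ (resultant f (derivative f))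
    refine ⟨C a⁻¹ * p.map (MvPolynomial.eval γ), C a⁻¹ * q.map (MvPolynomial.eval γ), ?_⟩
    have h2 : (C a⁻¹ * C a : ℚ[X]) = 1 := by rw [← C_mul, inv_mul_cancel₀ hγ, C_1]
    linear_combination C a⁻¹ * h1 + h2

end Separability

section Main

theorem natDegree_lineMap_le {σ : Type} (b c : σ → ℚ) (p : MvPolynomial σ ℚ) :
    (lineMap b c p).natDegree ≤ p.totalDegree := by
  refine (MvPolynomial.aeval_natDegree_le p le_rfl _ (n := 1) fun i => ?_).trans_eq (mul_one _)
  exact natDegree_linear_le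

theorem irreducible_map_lineMap_of_lift {σ : Type} {N : ℕ} {f : (MvPolynomial σ ℚ)[X]}
    (hf : Irreducible f) (hmonic : f.Monic) (hN : ∀ i, (f.coeff i).totalDegree ≤ N)
    {β γ : σ → ℚ}
    (hsep : IsCoprime (f.map (MvPolynomial.eval γ)) (derivative (f.map (MvPolynomial.eval γ))))
    {c : ℚ} (hc : c ≠ 0)
    (hlift : ∀ p q : ℚ[X][X], p.natDegree < f.natDegree → q.natDegree < f.natDegree →
      (∀ i, (p.coeff i).natDegree < N + 1) → (∀ i, (q.coeff i).natDegree < N + 1) →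
      ruppert (f.map (lineMap β γ)) p q = 0 → ∃ W H : (MvPolynomial σ ℚ)[X][X],
        ruppert (f.map (lineMap MvPolynomial.X (fun i => MvPolynomial.C (γ i)))) W H = 0 ∧
        W.map (mapRingHom (MvPolynomial.eval β)) = C (C c) * p) :
    Irreducible (f.map (lineMap β γ)) := by
  have hd : f.natDegree ≠ 0 := fun h0 =>
    hf.not_isUnit (hmonic.natDegree_eq_zero.1 h0 ▸ isUnit_one)
  have hm : (f.map (lineMap β γ)).Monic := hmonic.map _
  have hne : f.map (lineMap β γ) ≠ 1 := fun h => hd <| by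
    rw [← hmonic.natDegree_map (lineMap β γ), h, natDegree_one]
  rw [hm.irreducible_iff_natDegree]
  refine ⟨hne, fun h₁ h₂ hm₁ hm₂ hmul => ?_⟩
  by_contra! hd12
  obtain ⟨hd₁, hd₂⟩ := hd12
  have hdeg : h₁.natDegree + h₂.natDegree = f.natDegree := by
    rw [← hm₁.natDegree_mul hm₂, hmul, hmonic.natDegree_map]
  have hswap : (Bivariate.swap h₁).natDegree + (Bivariate.swap h₂).natDegree ≤ N := by
    rw [← natDegree_mul, ← map_mul, hmul]
    · refine natDegree_swap_le fun i => ?_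
      rw [coeff_map]
      exact (natDegree_lineMap_le β γ _).trans (hN i)
    · exact (map_ne_zero_iff _ Bivariate.swap.injective).2 hm₁.ne_zero
    · exact (map_ne_zero_iff _ Bivariate.swap.injective).2 hm₂.ne_zero
  have hpd : (derivative h₁ * h₂).natDegree < f.natDegree := by
    have := natDegree_derivative_lt hd₁
    have := natDegree_mul_le (p := derivative h₁) (q := h₂)
    lia
  have hqd : (innerDerivative h₁ * h₂).natDegree < f.natDegree := by
    have h1 : (innerDerivative h₁).natDegree < h₁.natDegree := by
      rw [Nat.lt_iff_le_pred (Nat.pos_of_ne_zero hd₁), natDegree_le_iff_coeff_eq_zero]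
      intro i hi
      rw [coeff_innerDerivative]
      rcases (show h₁.natDegree ≤ i by lia).eq_or_lt with rfl | hi
      · rw [hm₁.coeff_natDegree, derivative_one]
      · rw [coeff_eq_zero_of_natDegree_lt hi, derivative_zero]
    have := natDegree_mul_le (p := innerDerivative h₁) (q := h₂)
    lia
  have hpe (i : ℕ) : ((derivative h₁ * h₂).coeff i).natDegree < N + 1 := by
    rw [Nat.lt_succ_iff]
    refine (natDegree_coeff_le_natDegree_swap _ i).trans (le_trans ?_ hswap)
    rw [map_mul]
    refine natDegree_mul_le.trans (Nat.add_le_add_right ?_ _)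
    refine natDegree_swap_le fun j => ?_
    have : ((j : ℚ[X]) + 1) = C (j + 1 : ℚ) := by simp
    rw [coeff_derivative, this]
    exact (natDegree_mul_C_le _ _).trans (natDegree_coeff_le_natDegree_swap _ _)
  have hqe (i : ℕ) : ((innerDerivative h₁ * h₂).coeff i).natDegree < N + 1 := by
    rw [Nat.lt_succ_iff]
    refine (natDegree_coeff_le_natDegree_swap _ i).trans (le_trans ?_ hswap)
    rw [map_mul, swap_innerDerivative]
    exact natDegree_mul_le.trans
      (Nat.add_le_add_right ((natDegree_derivative_le _).trans (Nat.sub_le _ _)) _)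
  obtain ⟨W, H, hrup, hW⟩ := hlift _ _ hpd hqd hpe hqe (by rw [← hmul, ruppert_mul])
  obtain ⟨Ω, _, _, _, _⟩ : ∃ (Ω : Type) (_ : Field Ω) (_ : Algebra ℚ Ω),
      IsAlgClosed Ω ∧ Algebra.IsAlgebraic ℚ Ω :=
    ⟨AlgebraicClosure ℚ, inferInstance, AlgebraicClosure.instAlgebra ℚ, inferInstance,
      AlgebraicClosure.isAlgebraic ℚ⟩
  exact ruppert_ne_zero_of_factor hf hmonic β γ hsep Ω hm₁ hm₂ hd₁ hd₂ hmul hc hW hrup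

theorem degree_bound_le {d δ : ℕ} (hd : d ≤ δ) (hδ : 2 ≤ δ) :
    (d * (δ + 1) + d * (δ + 1)) * δ + (d + d) * δ ≤ 2 * δ ^ 5 :=
  calc
    _ = 2 * (d * (δ * (δ + 2))) := by ring
    _ ≤ 2 * (δ * (δ * (δ ^ 3))) := by
      have : δ + 2 ≤ δ ^ 3 := by nlinarith [Nat.mul_le_mul hδ hδ, sq_nonneg δ]
      gcongr
    _ = 2 * δ ^ 5 := by ring

/-- The effective Hilbert irreducibility theorem, with `ℚ[z₁,…,zₙ][x]` and `ℚ[t][x]` as polynomial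
rings. -/
theorem exists_forall_irreducible_map_lineMap {σ : Type} {δ : ℕ} {f : (MvPolynomial σ ℚ)[X]}
    (hf : Irreducible f) (hmonic : f.Monic) (hN : ∀ i, (f.coeff i).totalDegree ≤ δ)
    (hdδ : f.natDegree ≤ δ) :
    ∃ G : MvPolynomial (σ ⊕ σ) ℚ, G ≠ 0 ∧ G.totalDegree ≤ 2 * δ ^ 5 ∧
      ∀ β γ : σ → ℚ, MvPolynomial.eval (Sum.elim β γ) G ≠ 0 →
        Irreducible (f.map (lineMap β γ)) := by
  have hd : f.natDegree ≠ 0 := fun h0 =>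
    hf.not_isUnit (hmonic.natDegree_eq_zero.1 h0 ▸ isUnit_one)
  rcases (Nat.one_le_iff_ne_zero.2 hd).eq_or_lt with hd1 | hd2
  · refine ⟨1, one_ne_zero, by simp, fun β γ _ => ?_⟩
    have hm : (f.map (lineMap β γ)).Monic := hmonic.map _
    have hdm : (f.map (lineMap β γ)).natDegree = 1 := by rw [hmonic.natDegree_map, hd1]
    rw [hm.irreducible_iff_natDegree]
    refine ⟨fun h => ?_, fun h₁ h₂ hm₁ hm₂ hmul => ?_⟩
    · rw [h, natDegree_one] at hdm
      exact zero_ne_one hdm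
    · rw [← hmul, hm₁.natDegree_mul hm₂] at hdm
      lia
  · let b (i : σ) : MvPolynomial (σ ⊕ σ) ℚ := MvPolynomial.X (Sum.inl i)
    let c (i : σ) : MvPolynomial (σ ⊕ σ) ℚ := MvPolynomial.X (Sum.inr i)
    have hF : CoeffTotalDegreeLE δ (f.map (lineMap b c)) := fun i j => by
      rw [coeff_map]
      refine (totalDegree_coeff_lineMap_le (fun i => ?_) (fun i => ?_) _ j).trans (hN i)
      · exact (MvPolynomial.totalDegree_X _).le
      · exact (MvPolynomial.totalDegree_X _).le
    obtain ⟨Δ, hΔ, hΔdeg, hlift⟩ := exists_forall_exists_ruppert_lift f.natDegree (δ + 1) hF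
    obtain ⟨D, hD, hDdeg, hsep⟩ := exists_isCoprime_derivative_of_eval_ne_zero hf hmonic hN
    refine ⟨Δ * MvPolynomial.rename Sum.inr D, mul_ne_zero hΔ ?_, ?_, fun β γ h => ?_⟩
    · exact (map_ne_zero_iff _ (MvPolynomial.rename_injective _ Sum.inr_injective)).2 hD
    · refine (MvPolynomial.totalDegree_mul _ _).trans
        ((add_le_add hΔdeg ((MvPolynomial.totalDegree_rename_le _ _).trans hDdeg)).trans ?_)
      exact degree_bound_le hdδ (hd2.trans_le hdδ)
    · rw [map_mul, MvPolynomial.eval_rename, Sum.elim_comp_inr] at h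
      let ψ : MvPolynomial (σ ⊕ σ) ℚ →+* MvPolynomial σ ℚ :=
        (MvPolynomial.aeval (Sum.elim MvPolynomial.X fun i => MvPolynomial.C (γ i)) :
          MvPolynomial (σ ⊕ σ) ℚ →ₐ[ℚ] MvPolynomial σ ℚ)
      have hψ : (MvPolynomial.eval β).comp ψ = MvPolynomial.eval (Sum.elim β γ) := by
        refine MvPolynomial.ringHom_ext' (Subsingleton.elim _ _) fun i => ?_
        rcases i with i | i <;> simp [ψ]
      have hι : (MvPolynomial.eval (Sum.elim β γ)).comp MvPolynomial.C = RingHom.id ℚ :=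
        Subsingleton.elim _ _
      refine irreducible_map_lineMap_of_lift hf hmonic hN (hsep γ (right_ne_zero_of_mul h))
        (left_ne_zero_of_mul h) fun p q hpd hqd hpe hqe hpq => ?_
      have hmap (r : ℚ[X][X]) : (r.map (mapRingHom MvPolynomial.C)).map
          (mapRingHom (MvPolynomial.eval (Sum.elim β γ))) = r := by
        rw [Polynomial.map_map, mapRingHom_comp, hι, mapRingHom_id, Polynomial.map_id]
      have hcoeff (r : ℚ[X][X]) (i : ℕ) (hr : (r.coeff i).natDegree < δ + 1) :
          ((r.map (mapRingHom (MvPolynomial.C : ℚ →+* MvPolynomial (σ ⊕ σ) ℚ))).coeff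
            i).natDegree < δ + 1 := by
        rw [coeff_map]
        exact natDegree_map_le.trans_lt hr
      obtain ⟨W, H, hrup, hW⟩ := hlift (p.map (mapRingHom MvPolynomial.C))
        (q.map (mapRingHom MvPolynomial.C)) (natDegree_map_le.trans_lt hpd)
        (natDegree_map_le.trans_lt hqd) (fun i => hcoeff p i (hpe i))
        (fun i => hcoeff q i (hqe i))
      refine ⟨W.map (mapRingHom ψ), H.map (mapRingHom ψ), ?_, ?_⟩
      · have h1 : (mapRingHom ψ).comp (lineMap b c) =
            lineMap MvPolynomial.X (fun i => MvPolynomial.C (γ i)) := by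
          rw [mapRingHom_comp_lineMap]
          congr 1 <;> funext i <;> simp [ψ, b, c]
        rw [← h1, ← Polynomial.map_map, ruppert_map, hrup, Polynomial.map_zero]
      · rw [Polynomial.map_map, mapRingHom_comp, hψ, hW, hmap]
        have h1 : (mapRingHom (MvPolynomial.eval (Sum.elim β γ))).comp (lineMap b c) =
            lineMap β γ := by
          rw [mapRingHom_comp_lineMap]
          congr 1 <;> funext i <;> simp [b, c]
        rw [← ruppert_map, hmap, hmap, Polynomial.map_map, h1, hpq]

end Main

theorem irreducible_aeval_iff_irreducible_map_lineMap {σ : Type}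
    (g : MvPolynomial (Option σ) ℚ) (β γ : σ → ℚ) :
    Irreducible (MvPolynomial.aeval (fun i : Option σ => i.elim (MvPolynomial.X 0)
      (fun j => MvPolynomial.C (β j) * MvPolynomial.X 1 + MvPolynomial.C (γ j)) :
        Option σ → MvPolynomial (Fin 2) ℚ) g) ↔
      Irreducible ((MvPolynomial.optionEquivLeft ℚ σ g).map (lineMap β γ)) := by
  let e : MvPolynomial (Fin 2) ℚ ≃ₐ[ℚ] ℚ[X][X] := (MvPolynomial.finSuccEquiv ℚ 1).trans
    (Polynomial.mapAlgEquiv (MvPolynomial.uniqueAlgEquiv ℚ (Fin 1)))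
  have he : (e : MvPolynomial (Fin 2) ℚ →+* ℚ[X][X]).comp
      (MvPolynomial.aeval (fun i : Option σ => i.elim (MvPolynomial.X 0)
        (fun j => MvPolynomial.C (β j) * MvPolynomial.X 1 + MvPolynomial.C (γ j)) :
          Option σ → MvPolynomial (Fin 2) ℚ) : MvPolynomial (Option σ) ℚ →ₐ[ℚ] _) =
      (mapRingHom (lineMap β γ)).comp (MvPolynomial.optionEquivLeft ℚ σ :
        MvPolynomial (Option σ) ℚ →+* (MvPolynomial σ ℚ)[X]) := by
    have hX0 : e (MvPolynomial.X 0) = X := by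
      simp [e, MvPolynomial.finSuccEquiv_X_zero]
    have hX1 : e (MvPolynomial.X 1) = C X := by
      have : (1 : Fin 2) = Fin.succ 0 := rfl
      rw [this, AlgEquiv.trans_apply, MvPolynomial.finSuccEquiv_X_succ]
      refine (Polynomial.map_C _).trans ?_
      exact congrArg C (MvPolynomial.aeval_X _ _)
    have hC (a : ℚ) : e (MvPolynomial.C a) = C (C a) := e.commutes a
    refine MvPolynomial.ringHom_ext' (Subsingleton.elim _ _) fun i => ?_
    rcases i with _ | i
    · simp [hX0]
    · simp [hX1, hC, lineMap_X]
  rw [← MulEquiv.irreducible_iff e]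
  exact iff_of_eq (congrArg Irreducible (congrArg (fun φ => φ g) he))

/-- (Effective Hilbert Irreducibility Theorem.) Let
`g ∈ ℚ[x,z₁,…,zₙ]` (modelled as `MvPolynomial (Option (Fin n)) ℚ` with `x = X none`)
be irreducible of total degree `δ` and monic in `x`.  Then there is a nonzero
polynomial `G` in `2n` variables of total degree at most `2δ⁵` such that whenever
`G(β,γ) ≠ 0`, the bivariate polynomial `g(x, β₁t+γ₁,…,βₙt+γₙ) ∈ ℚ[x,t]`
(modelled as `MvPolynomial (Fin 2) ℚ` with `x = X 0`, `t = X 1`) is irreducible. -/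
theorem stmt9 (n δ : ℕ) (g : MvPolynomial (Option (Fin n)) ℚ)
    (hirr : Irreducible g) (hdeg : g.totalDegree = δ)
    (hmonic : (MvPolynomial.optionEquivLeft ℚ (Fin n) g).Monic) :
    ∃ G : MvPolynomial (Fin n ⊕ Fin n) ℚ, G ≠ 0 ∧ G.totalDegree ≤ 2 * δ ^ 5 ∧
      ∀ β γ : Fin n → ℚ, MvPolynomial.eval (Sum.elim β γ) G ≠ 0 →
        Irreducible (MvPolynomial.aeval
          (fun i : Option (Fin n) => i.elim (MvPolynomial.X 0)
            (fun j => MvPolynomial.C (β j) * MvPolynomial.X 1 + MvPolynomial.C (γ j)) :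
            Option (Fin n) → MvPolynomial (Fin 2) ℚ) g) := by
  have hg : Irreducible (MvPolynomial.optionEquivLeft ℚ (Fin n) g) :=
    (MulEquiv.irreducible_iff (MvPolynomial.optionEquivLeft ℚ (Fin n))).2 hirr
  obtain ⟨G, hG, hGdeg, h⟩ := exists_forall_irreducible_map_lineMap hg hmonic (δ := δ)
    (fun i => hdeg ▸ MvPolynomial.totalDegree_coeff_optionEquivLeft_le ℚ (Fin n) g i) (by
      rw [MvPolynomial.natDegree_optionEquivLeft, ← hdeg]
      exact MvPolynomial.degreeOf_le_totalDegree g none)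
  exact ⟨G, hG, hGdeg, fun β γ hβγ =>
    (irreducible_aeval_iff_irreducible_map_lineMap g β γ).2 (h β γ hβγ)⟩
end

section
/- Let g ∈ ℚ[x,z₁,…,zₙ] be an irreducible polynomial of total degree δ in n+1 variables that is monic in x. Then there exist weight vectors w = (w₁,…,wₙ) and w' = (w₁',…,wₙ') in ℕⁿ such that the trivariate polynomial Ψ(g) = g(x, y^{w₁}t + y^{w₁'}, …, y^{wₙ}t + y^{wₙ'}) ∈ ℚ[x,y,t] is irreducible. -/
namespace Polynomial

/-- A polynomial `A` in `t` over `R[x]` deforms `A₀ ∈ R[x]` if it specializes to `A₀` at `t = 0` and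
its other coefficients have degree smaller than that of `A₀`. -/
def IsDeformation {R : Type*} [CommRing R] (A₀ : R[X]) (A : R[X][X]) : Prop :=
  A.coeff 0 = A₀ ∧ ∀ k ≠ 0, (A.coeff k).degree < A₀.degree

namespace IsDeformation

variable {R : Type*} [CommRing R] {A₀ : R[X]} {A : R[X][X]}

lemma degree_eval_divX_lt [Nontrivial R] (h : IsDeformation A₀ A) (hA₀ : A₀.Monic) :
    (A.divX.eval 1).degree < A₀.degree := by
  simp only [eval_eq_sum_range, one_pow, mul_one, coeff_divX]
  refine Finset.sum_induction _ (fun p : R[X] ↦ p.degree < A₀.degree)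
    (fun p q hp hq ↦ (degree_add_le p q).trans_lt (max_lt hp hq)) ?_
    fun k _ ↦ h.2 _ k.succ_ne_zero
  rw [degree_zero]
  exact bot_lt_iff_ne_bot.2 (degree_ne_bot.2 hA₀.ne_zero)

lemma eval_one_eq (h : IsDeformation A₀ A) : A.eval 1 = A₀ + A.divX.eval 1 := by
  conv_lhs => rw [← divX_mul_X_add A]
  simp [h.1, add_comm]

lemma monic_eval_one [Nontrivial R] (h : IsDeformation A₀ A) (hA₀ : A₀.Monic) : (A.eval 1).Monic :=
  h.eval_one_eq ▸ hA₀.add_of_left (h.degree_eval_divX_lt hA₀)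

lemma natDegree_eval_one [Nontrivial R] (h : IsDeformation A₀ A) (hA₀ : A₀.Monic) :
    (A.eval 1).natDegree = A₀.natDegree := by
  rw [h.eval_one_eq]
  exact natDegree_eq_of_degree_eq (degree_add_eq_left_of_degree_lt (h.degree_eval_divX_lt hA₀))

end IsDeformation

section Swap

variable {R S : Type*} [CommRing R] [CommRing S]

lemma coeff_coeff_swap (p : R[X][X]) (i j : ℕ) :
    ((Bivariate.swap p).coeff i).coeff j = (p.coeff j).coeff i := by
  induction p using Polynomial.induction_on' with
  | add p q hp hq => simp only [map_add, coeff_add, hp, hq]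
  | monomial n f =>
    induction f using Polynomial.induction_on' with
    | add p q hp hq => simp only [map_add, coeff_add, hp, hq]
    | monomial m r =>
      rw [Bivariate.swap_monomial_monomial]
      simp only [coeff_monomial]
      split_ifs <;> simp_all [coeff_monomial]

lemma swap_map_mapRingHom (φ : R →+* S) (p : R[X][X]) :
    Bivariate.swap (p.map (mapRingHom φ)) = (Bivariate.swap p).map (mapRingHom φ) := by
  ext i j
  simp [coeff_coeff_swap]

lemma eval_C_swap (p : R[X][X]) (r : R) :
    (Bivariate.swap p).eval (C r) = p.map (evalRingHom r) := by
  induction p using Polynomial.induction_on' with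
  | add p q hp hq => simp only [map_add, eval_add, Polynomial.map_add, hp, hq]
  | monomial n f =>
    rw [Bivariate.swap_monomial, ← C_mul_X_pow_eq_monomial]
    simp [eval_map, eval₂_at_apply]

lemma Monic.isDeformation_swap [Nontrivial R] {A : R[X][X]} (hA : A.Monic) :
    IsDeformation (A.map (evalRingHom 0)) (Bivariate.swap A) := by
  refine ⟨?_, fun k hk ↦ ?_⟩
  · rw [← eval_C_swap, coeff_zero_eq_eval_zero, C_0]
  · rw [hA.degree_map, degree_eq_natDegree hA.ne_zero, degree_lt_iff_coeff_zero]
    intro m hm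
    rw [coeff_coeff_swap]
    rcases hm.eq_or_lt with rfl | hm
    · simp [hA.coeff_natDegree, coeff_one, hk]
    · simp [coeff_eq_zero_of_natDegree_lt hm]

end Swap

section Hensel

variable {K R : Type*} [Field K] [CommRing R] [Algebra K R] {A₀ B₀ : K[X]}

/-- Uniqueness in Hensel lifting: the coefficients of a lift of the factorization `A₀ * B₀` are
given by universal formulas in the parameter ring `R`. -/
lemma exists_coeff_deformation [Nontrivial R] (hA₀ : A₀.Monic) (hB₀ : B₀.Monic)
    (hco : IsCoprime A₀ B₀) (G : R[X][X]) (k : ℕ) :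
    ∃ P Q : R[X],
      (k = 0 → P = A₀.map (algebraMap K R) ∧ Q = B₀.map (algebraMap K R)) ∧
      (k ≠ 0 → P.degree < (A₀.map (algebraMap K R)).degree ∧
        Q.degree < (B₀.map (algebraMap K R)).degree) ∧
      ∀ (φ : R →ₐ[K] K) (A B : K[X][X]), IsDeformation A₀ A → IsDeformation B₀ B →
        A * B = G.map (mapRingHom (φ : R →+* K)) →
        A.coeff k = P.map (φ : R →+* K) ∧ B.coeff k = Q.map (φ : R →+* K) := by
  have hmap (φ : R →ₐ[K] K) (p : K[X]) :
      (p.map (algebraMap K R)).map (φ : R →+* K) = p := by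
    rw [Polynomial.map_map, AlgHom.comp_algebraMap, Algebra.algebraMap_self, Polynomial.map_id]
  induction k using Nat.strong_induction_on with
  | _ k ih =>
  rcases eq_or_ne k 0 with rfl | hk
  · exact ⟨_, _, fun _ ↦ ⟨rfl, rfl⟩, fun h ↦ (h rfl).elim, fun φ A B hA hB _ ↦
      ⟨by rw [hA.1, hmap], by rw [hB.1, hmap]⟩⟩
  choose! P Q _ _ hPQ using ih
  obtain ⟨u, v, huv⟩ := hco
  set I := (Finset.HasAntidiagonal.antidiagonal k).filter fun x ↦ x.1 ≠ 0 ∧ x.2 ≠ 0 with hI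
  set c : R[X] := G.coeff k - ∑ x ∈ I, P x.1 * Q x.2
  refine ⟨(c * v.map (algebraMap K R)) %ₘ A₀.map (algebraMap K R),
    (c * u.map (algebraMap K R)) %ₘ B₀.map (algebraMap K R), fun h ↦ (hk h).elim,
    fun _ ↦ ⟨degree_modByMonic_lt _ (hA₀.map _), degree_modByMonic_lt _ (hB₀.map _)⟩, ?_⟩
  intro φ A B hA hB hAB
  have hsum : A₀ * B.coeff k + A.coeff k * B₀ = c.map (φ : R →+* K) := by
    have hG : (A * B).coeff k = (G.coeff k).map (φ : R →+* K) := by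
      rw [hAB, coeff_map, coe_mapRingHom]
    have hlow : (∑ x ∈ I, P x.1 * Q x.2).map (φ : R →+* K) =
        ∑ x ∈ I, A.coeff x.1 * B.coeff x.2 := by
      rw [Polynomial.map_sum]
      refine Finset.sum_congr rfl fun x hx ↦ ?_
      simp only [hI, Finset.mem_filter, Finset.HasAntidiagonal.mem_antidiagonal] at hx
      rw [Polynomial.map_mul, (hPQ x.1 (by omega) φ A B hA hB hAB).1,
        (hPQ x.2 (by omega) φ A B hA hB hAB).2]
    have hend : (Finset.HasAntidiagonal.antidiagonal k).filter (fun x ↦ ¬(x.1 ≠ 0 ∧ x.2 ≠ 0)) =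
        {(0, k), (k, 0)} := by
      ext ⟨i, j⟩
      simp only [Finset.mem_filter, Finset.HasAntidiagonal.mem_antidiagonal, Finset.mem_insert,
        Finset.mem_singleton, Prod.mk.injEq]
      omega
    rw [Polynomial.map_sub, hlow, ← hG, coeff_mul,
      ← Finset.sum_filter_add_sum_filter_not _ fun x : ℕ × ℕ ↦ x.1 ≠ 0 ∧ x.2 ≠ 0, hend,
      Finset.sum_pair (by simp [hk.symm]), hA.1, hB.1]
    ring
  rw [map_modByMonic _ (hA₀.map _), map_modByMonic _ (hB₀.map _), Polynomial.map_mul,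
    Polynomial.map_mul, hmap, hmap, hmap, hmap, ← hsum]
  refine ⟨(div_modByMonic_unique (v * B.coeff k - u * A.coeff k) _ hA₀ ⟨?_, hA.2 k hk⟩).2.symm,
    (div_modByMonic_unique (u * A.coeff k - v * B.coeff k) _ hB₀ ⟨?_, hB.2 k hk⟩).2.symm⟩
  · linear_combination (-A.coeff k) * huv
  · linear_combination (-B.coeff k) * huv

lemma exists_deformation [Nontrivial R] (hA₀ : A₀.Monic) (hB₀ : B₀.Monic) (hco : IsCoprime A₀ B₀)
    (G : R[X][X]) :
    ∃ P Q : R[X][X], IsDeformation (A₀.map (algebraMap K R)) P ∧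
      IsDeformation (B₀.map (algebraMap K R)) Q ∧
      ∀ (φ : R →ₐ[K] K) (A B : K[X][X]), IsDeformation A₀ A → IsDeformation B₀ B →
        A * B = G.map (mapRingHom (φ : R →+* K)) →
        A = P.map (mapRingHom (φ : R →+* K)) ∧ B = Q.map (mapRingHom (φ : R →+* K)) := by
  choose p q h₀ hlt hpq using exists_coeff_deformation (R := R) hA₀ hB₀ hco G
  set N := G.natDegree
  have hcoeff (p : ℕ → R[X]) (k : ℕ) :
      (∑ i ∈ Finset.range (N + 1), monomial i (p i)).coeff k = if k ≤ N then p k else 0 := by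
    simp [coeff_monomial]
  have hdef {p : ℕ → R[X]} {A₀ : K[X]} (hA₀ : A₀.Monic) (h₀ : p 0 = A₀.map (algebraMap K R))
      (hlt : ∀ k ≠ 0, (p k).degree < (A₀.map (algebraMap K R)).degree) :
      IsDeformation (A₀.map (algebraMap K R)) (∑ i ∈ Finset.range (N + 1), monomial i (p i)) := by
    refine ⟨by rw [hcoeff, if_pos N.zero_le, h₀], fun k hk ↦ ?_⟩
    rw [hcoeff]
    split_ifs
    · exact hlt k hk
    · rw [degree_zero]
      exact bot_lt_iff_ne_bot.2 (degree_ne_bot.2 (hA₀.map _).ne_zero)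
  refine ⟨∑ i ∈ Finset.range (N + 1), monomial i (p i),
    ∑ i ∈ Finset.range (N + 1), monomial i (q i),
    hdef hA₀ (h₀ 0 rfl).1 fun k hk ↦ (hlt k hk).1, hdef hB₀ (h₀ 0 rfl).2 fun k hk ↦ (hlt k hk).2,
    fun φ A B hA hB hAB ↦ ?_⟩
  have hA0 : A ≠ 0 := by
    rintro rfl
    exact hA₀.ne_zero (by simpa using hA.1.symm)
  have hB0 : B ≠ 0 := by
    rintro rfl
    exact hB₀.ne_zero (by simpa using hB.1.symm)
  have hdeg : A.natDegree + B.natDegree ≤ N := by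
    rw [← natDegree_mul hA0 hB0, hAB]
    exact natDegree_map_le
  constructor
  · refine Polynomial.ext fun k ↦ ?_
    rw [coeff_map, hcoeff]
    split_ifs with hk
    · exact (hpq k φ A B hA hB hAB).1
    · rw [coeff_eq_zero_of_natDegree_lt (by omega), map_zero]
  · refine Polynomial.ext fun k ↦ ?_
    rw [coeff_map, hcoeff]
    split_ifs with hk
    · exact (hpq k φ A B hA hB hAB).2
    · rw [coeff_eq_zero_of_natDegree_lt (by omega), map_zero]

end Hensel

lemma finite_setOf_monic_dvd {K : Type*} [Field K] {f : K[X]} (hf : f ≠ 0) :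
    {p : K[X] | p.Monic ∧ p ∣ f}.Finite := by
  classical
  refine ((UniqueFactorizationMonoid.normalizedFactors f).powerset.map
    Multiset.prod).toFinset.finite_toSet.subset fun p hp ↦ ?_
  simp only [Finset.mem_coe, Multiset.mem_toFinset, Multiset.mem_map, Multiset.mem_powerset]
  exact ⟨_, (UniqueFactorizationMonoid.dvd_iff_normalizedFactors_le_normalizedFactors
    hp.1.ne_zero hf).1 hp.2, by
      rw [UniqueFactorizationMonoid.prod_normalizedFactors_eq hp.1.ne_zero,
        hp.1.normalize_eq_self]⟩

end Polynomial

namespace MvPolynomial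

open Polynomial (evalRingHom mapRingHom IsDeformation)

variable {σ K : Type*} [Field K]

/-- The restriction of a polynomial function to the line `t ↦ b + t • a`. -/
noncomputable def line (b a : σ → K) : MvPolynomial σ K →ₐ[K] Polynomial K :=
  aeval fun i ↦ Polynomial.C (b i) + Polynomial.C (a i) * Polynomial.X

/-- The restriction of a polynomial function to the generic line through `b`. -/
noncomputable def genericLine (b : σ → K) :
    MvPolynomial σ K →ₐ[K] Polynomial (MvPolynomial σ K) :=
  aeval fun i ↦ Polynomial.C (C (b i)) + Polynomial.C (X i) * Polynomial.X

lemma mapRingHom_comp_genericLine (b a : σ → K) :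
    (mapRingHom ((aeval a : MvPolynomial σ K →ₐ[K] K) : MvPolynomial σ K →+* K)).comp
      (genericLine b : MvPolynomial σ K →+* Polynomial (MvPolynomial σ K)) =
        (line b a : MvPolynomial σ K →+* Polynomial K) := by
  ext i <;> simp [genericLine, line]

lemma evalRingHom_comp_line (b a : σ → K) :
    (evalRingHom 0).comp (line b a : MvPolynomial σ K →+* Polynomial K) = eval b := by
  ext i <;> simp [line]

/-- Translation by `b` as an automorphism of the polynomial ring. -/
noncomputable def translate (b : σ → K) : MvPolynomial σ K ≃ₐ[K] MvPolynomial σ K :=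
  .ofAlgHom (aeval fun i ↦ C (b i) + X i) (aeval fun i ↦ X i - C (b i))
    (by ext i; simp) (by ext i; simp)

lemma evalRingHom_comp_genericLine (b : σ → K) :
    (evalRingHom 1).comp
      (genericLine b : MvPolynomial σ K →+* Polynomial (MvPolynomial σ K)) = translate b := by
  ext i <;> simp [genericLine, translate]

variable {h : Polynomial (MvPolynomial σ K)}

lemma exists_obstruction (hm : h.Monic) (hirr : Irreducible h) (b : σ → K)
    {A₀ B₀ : Polynomial K} (hA₀ : A₀.Monic) (hB₀ : B₀.Monic) (hco : IsCoprime A₀ B₀)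
    (hA₀' : A₀.natDegree ≠ 0) (hB₀' : B₀.natDegree ≠ 0) :
    ∃ c : MvPolynomial σ K, c ≠ 0 ∧ ∀ (a : σ → K) (A B : Polynomial (Polynomial K)),
      A.Monic → B.Monic → A * B = h.map (line b a : MvPolynomial σ K →+* Polynomial K) →
      A.map (evalRingHom 0) = A₀ → B.map (evalRingHom 0) = B₀ → eval a c = 0 := by
  set H := h.map (genericLine b : MvPolynomial σ K →+* Polynomial (MvPolynomial σ K)) with hH
  obtain ⟨P, Q, hP, hQ, hPQ⟩ := Polynomial.exists_deformation (R := MvPolynomial σ K) hA₀ hB₀ hco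
    (Polynomial.Bivariate.swap H)
  have hne : Polynomial.Bivariate.swap H - P * Q ≠ 0 := by
    intro h0
    have hswap : Polynomial.Bivariate.swap H = P * Q := eq_of_sub_eq_zero h0
    have hm' := hm.map (translate b : MvPolynomial σ K →+* MvPolynomial σ K)
    have hirr' : Irreducible (h.map (translate b : MvPolynomial σ K →+* MvPolynomial σ K)) :=
      (MulEquiv.irreducible_iff (Polynomial.mapEquiv (translate b).toRingEquiv)).2 hirr
    have heq : P.eval 1 * Q.eval 1 =
        h.map (translate b : MvPolynomial σ K →+* MvPolynomial σ K) := by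
      rw [← Polynomial.eval_mul, ← hswap, ← Polynomial.C_1, Polynomial.eval_C_swap, hH,
        Polynomial.map_map, evalRingHom_comp_genericLine]
    have := (hm'.irreducible_iff_natDegree.1 hirr').2 _ _ (hP.monic_eval_one (hA₀.map _))
      (hQ.monic_eval_one (hB₀.map _)) heq
    rw [hP.natDegree_eval_one (hA₀.map _), hQ.natDegree_eval_one (hB₀.map _), hA₀.natDegree_map,
      hB₀.natDegree_map] at this
    tauto
  obtain ⟨i, j, hij⟩ : ∃ i j, ((Polynomial.Bivariate.swap H - P * Q).coeff i).coeff j ≠ 0 := by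
    by_contra! h0
    exact hne (by ext i j : 2; simpa using h0 i j)
  refine ⟨_, hij, ?_⟩
  rintro a A B hA hB hAB rfl rfl
  have hswap : Polynomial.Bivariate.swap A * Polynomial.Bivariate.swap B =
      (Polynomial.Bivariate.swap H).map
        (mapRingHom ((aeval a : MvPolynomial σ K →ₐ[K] K) : MvPolynomial σ K →+* K)) := by
    rw [← map_mul, hAB, ← Polynomial.swap_map_mapRingHom, hH, Polynomial.map_map,
      mapRingHom_comp_genericLine]
  obtain ⟨hPA, hQB⟩ := hPQ (aeval a) _ _ hA.isDeformation_swap hB.isDeformation_swap hswap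
  have hzero : (Polynomial.Bivariate.swap H - P * Q).map
      (mapRingHom ((aeval a : MvPolynomial σ K →ₐ[K] K) : MvPolynomial σ K →+* K)) = 0 := by
    rw [Polynomial.map_sub, Polynomial.map_mul, ← hPA, ← hQB, hswap, sub_self]
  have := congr((Polynomial.coeff $hzero i).coeff j)
  rwa [Polynomial.coeff_map, Polynomial.coe_mapRingHom, Polynomial.coeff_map,
    coe_aeval_eq_eval, Polynomial.coeff_zero, Polynomial.coeff_zero] at this

/-- A monic irreducible polynomial stays irreducible on some line through a point at which it
specializes to a separable polynomial, with direction chosen in a box with infinite sides. -/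
lemma exists_irreducible_map_line (hm : h.Monic) (hirr : Irreducible h) (b : σ → K)
    (hsep : (h.map (eval b)).Separable) {s : Set K} (hs : s.Infinite) :
    ∃ a : σ → K, (∀ i, a i ∈ s) ∧
      Irreducible (h.map (line b a : MvPolynomial σ K →+* Polynomial K)) := by
  have hfactor {a : σ → K} {A B : Polynomial (Polynomial K)}
      (hAB : A * B = h.map (line b a : MvPolynomial σ K →+* Polynomial K)) :
      A.map (evalRingHom 0) * B.map (evalRingHom 0) = h.map (eval b) := by
    rw [← Polynomial.map_mul, hAB, Polynomial.map_map, evalRingHom_comp_line]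
  have hobs (A₀ : Polynomial K) : ∃ c : MvPolynomial σ K, c ≠ 0 ∧
      ∀ (a : σ → K) (A B : Polynomial (Polynomial K)), A.Monic → B.Monic →
        A.natDegree ≠ 0 → B.natDegree ≠ 0 →
        A * B = h.map (line b a : MvPolynomial σ K →+* Polynomial K) →
        A.map (evalRingHom 0) = A₀ → eval a c = 0 := by
    by_cases hex : ∃ (a : σ → K) (A B : Polynomial (Polynomial K)), A.Monic ∧ B.Monic ∧
        A.natDegree ≠ 0 ∧ B.natDegree ≠ 0 ∧
        A * B = h.map (line b a : MvPolynomial σ K →+* Polynomial K) ∧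
        A.map (evalRingHom 0) = A₀
    · obtain ⟨a, A, B, hA, hB, hA', hB', hAB, rfl⟩ := hex
      obtain ⟨c, hc, hca⟩ := exists_obstruction hm hirr b (hA.map (evalRingHom 0))
        (hB.map (evalRingHom 0)) (hsep.of_dvd (hfactor hAB).dvd).isCoprime
        (by rwa [hA.natDegree_map]) (by rwa [hB.natDegree_map])
      refine ⟨c, hc, fun a' A' B' hA₁ hB₁ _ _ hAB₁ hA₀ ↦ hca a' A' B' hA₁ hB₁ hAB₁ hA₀ ?_⟩
      have := (hfactor hAB₁).trans (hfactor hAB).symm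
      rw [hA₀] at this
      exact mul_left_cancel₀ (hA.map _).ne_zero this
    · exact ⟨1, one_ne_zero, fun a A B h₁ h₂ h₃ h₄ h₅ h₆ ↦
        (hex ⟨a, A, B, h₁, h₂, h₃, h₄, h₅, h₆⟩).elim⟩
  choose c hc hca using hobs
  have hfin := Polynomial.finite_setOf_monic_dvd (hm.map (eval b)).ne_zero
  have hprod : ∏ A₀ ∈ hfin.toFinset, c A₀ ≠ 0 := Finset.prod_ne_zero_iff.2 fun A₀ _ ↦ hc A₀
  obtain ⟨a, ha, hane⟩ : ∃ a ∈ Set.pi Set.univ fun _ : σ ↦ s,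
      eval a (∏ A₀ ∈ hfin.toFinset, c A₀) ≠ 0 := by
    by_contra! h0
    exact hprod (funext_set _ (fun _ ↦ hs) fun a ha ↦ by rw [h0 a ha, map_zero])
  refine ⟨a, fun i ↦ ha i trivial,
    (hm.map (line b a : MvPolynomial σ K →+* Polynomial K)).irreducible_iff_natDegree.2
      ⟨fun h1 ↦ ?_, fun A B hA hB hAB ↦ ?_⟩⟩
  · refine hirr.ne_one (Polynomial.eq_one_of_monic_natDegree_zero hm ?_)
    rw [← hm.natDegree_map (line b a : MvPolynomial σ K →+* Polynomial K), h1,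
      Polynomial.natDegree_one]
  · by_contra! hdeg
    rw [map_prod, Finset.prod_ne_zero_iff] at hane
    exact hane (A.map (evalRingHom 0))
      (hfin.mem_toFinset.2 ⟨hA.map _, Dvd.intro _ (hfactor hAB)⟩)
      (hca _ a A B hA hB hdeg.1 hdeg.2 hAB rfl)

lemma exists_separable_map_eval [CharZero K] (hm : h.Monic) (hirr : Irreducible h)
    {s : Set K} (hs : s.Infinite) :
    ∃ b : σ → K, (∀ i, b i ∈ s) ∧ (h.map (eval b)).Separable := by
  have hinj := IsFractionRing.injective (MvPolynomial σ K) (FractionRing (MvPolynomial σ K))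
  have hdeg : h.natDegree ≠ 0 := fun h0 ↦
    hirr.ne_one (Polynomial.eq_one_of_monic_natDegree_zero hm h0)
  have hres : h.resultant h.derivative ≠ 0 := by
    have hsep := ((hm.irreducible_iff_irreducible_map_fraction_map
      (K := FractionRing (MvPolynomial σ K))).1 hirr).separable
    have := Polynomial.resultant_ne_zero _ _ hsep
    rw [Polynomial.derivative_map, Polynomial.natDegree_map_eq_of_injective hinj,
      Polynomial.natDegree_map_eq_of_injective hinj, Polynomial.resultant_map_map] at this
    exact fun h0 ↦ this (by rw [h0, map_zero])
  obtain ⟨b, hb, hbne⟩ : ∃ b ∈ Set.pi Set.univ fun _ : σ ↦ s,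
      eval b (h.resultant h.derivative) ≠ 0 := by
    by_contra! h0
    exact hres (funext_set _ (fun _ ↦ hs) fun b hb ↦ by rw [h0 b hb, map_zero])
  obtain ⟨p, q, -, -, hpq⟩ := Polynomial.exists_mul_add_mul_eq_C_resultant h h.derivative
    le_rfl le_rfl (.inl hdeg)
  refine ⟨b, fun i ↦ hb i trivial, ?_⟩
  replace hpq := congr(Polynomial.map (eval b) $hpq)
  rw [Polynomial.map_add, Polynomial.map_mul, Polynomial.map_mul, Polynomial.map_C,
    ← Polynomial.derivative_map] at hpq
  refine (Polynomial.separable_def' _).2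
    ⟨Polynomial.C (eval b (h.resultant h.derivative))⁻¹ * p.map (eval b),
    Polynomial.C (eval b (h.resultant h.derivative))⁻¹ * q.map (eval b), ?_⟩
  rw [mul_assoc, mul_assoc, ← mul_add, mul_comm (p.map _), mul_comm (q.map _), hpq,
    ← Polynomial.C_mul, inv_mul_cancel₀ hbne, Polynomial.C_1]

lemma finSuccEquiv_aeval_elim {R : Type*} [CommRing R] {n : ℕ} (w w' : Fin n → ℕ)
    (g : MvPolynomial (Option (Fin n)) R) :
    finSuccEquiv R 2 (aeval (fun i : Option (Fin n) ↦ i.elim (X 0)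
      (fun j ↦ X 1 ^ w j * X 2 + X 1 ^ w' j) : Option (Fin n) → MvPolynomial (Fin 3) R) g) =
      (optionEquivLeft R (Fin n) g).map ((aeval fun j ↦ X 0 ^ w j * X 1 + X 0 ^ w' j :
        MvPolynomial (Fin n) R →ₐ[R] MvPolynomial (Fin 2) R) :
          MvPolynomial (Fin n) R →+* MvPolynomial (Fin 2) R) := by
  have h₀ : finSuccEquiv R 2 (X 0) = Polynomial.X := finSuccEquiv_X_zero
  have h₁ : finSuccEquiv R 2 (X 1) = Polynomial.C (X 0) := finSuccEquiv_X_succ (j := 0)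
  have h₂ : finSuccEquiv R 2 (X 2) = Polynomial.C (X 1) := finSuccEquiv_X_succ (j := 1)
  refine DFunLike.congr_fun (algHom_ext
    (f := (finSuccEquiv R 2).toAlgHom.comp (aeval _))
    (g := (Polynomial.mapAlgHom (aeval _)).comp (optionEquivLeft R (Fin n)).toAlgHom)
    fun i ↦ ?_) g
  cases i <;> simp [h₀, h₁, h₂]

end MvPolynomial


/-- Let `g ∈ ℚ[x,z₁,…,zₙ]` (modelled as `MvPolynomial (Option (Fin n)) ℚ`
with `x = X none`) be irreducible of total degree `δ` and monic in `x`.  Then there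
exist weight vectors `w, w' ∈ ℕⁿ` such that
`Ψ(g) = g(x, y^{w₁}t + y^{w₁'}, …, y^{wₙ}t + y^{wₙ'}) ∈ ℚ[x,y,t]`
(modelled as `MvPolynomial (Fin 3) ℚ` with `x = X 0`, `y = X 1`, `t = X 2`)
is irreducible. -/
theorem stmt10 (n δ : ℕ) (g : MvPolynomial (Option (Fin n)) ℚ)
    (hirr : Irreducible g) (hdeg : g.totalDegree = δ)
    (hmonic : (MvPolynomial.optionEquivLeft ℚ (Fin n) g).Monic) :
    ∃ w w' : Fin n → ℕ,
      Irreducible (MvPolynomial.aeval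
        (fun i : Option (Fin n) => i.elim (MvPolynomial.X 0)
          (fun j => MvPolynomial.X 1 ^ w j * MvPolynomial.X 2 + MvPolynomial.X 1 ^ w' j) :
          Option (Fin n) → MvPolynomial (Fin 3) ℚ) g) := by
  have hirr' : Irreducible (MvPolynomial.optionEquivLeft ℚ (Fin n) g) :=
    (MulEquiv.irreducible_iff (MvPolynomial.optionEquivLeft ℚ (Fin n))).2 hirr
  have hs : (Set.range fun k : ℕ ↦ (2 : ℚ) ^ k).Infinite :=
    Set.infinite_range_of_injective (pow_right_injective₀ (by norm_num) (by norm_num))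
  obtain ⟨b, hb, hsep⟩ := MvPolynomial.exists_separable_map_eval hmonic hirr' hs
  obtain ⟨a, ha, hline⟩ := MvPolynomial.exists_irreducible_map_line hmonic hirr' b hsep hs
  choose w hw using ha
  choose w' hw' using hb
  refine ⟨w, w', ?_⟩
  set θ : MvPolynomial (Fin n) ℚ →ₐ[ℚ] MvPolynomial (Fin 2) ℚ :=
    MvPolynomial.aeval fun j ↦
      MvPolynomial.X 0 ^ w j * MvPolynomial.X 1 + MvPolynomial.X 0 ^ w' j with hθ
  set η : MvPolynomial (Fin 2) ℚ →ₐ[ℚ] Polynomial ℚ :=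
    MvPolynomial.aeval ![Polynomial.C 2, Polynomial.X] with hη
  have hηθ : (η : MvPolynomial (Fin 2) ℚ →+* Polynomial ℚ).comp
      (θ : MvPolynomial (Fin n) ℚ →+* MvPolynomial (Fin 2) ℚ) = MvPolynomial.line b a := by
    ext i : 2
    · simp
    · simp [hη, hθ, MvPolynomial.line, ← hw, ← hw', add_comm]
  rw [← MulEquiv.irreducible_iff (MvPolynomial.finSuccEquiv ℚ 2),
    MvPolynomial.finSuccEquiv_aeval_elim]
  refine Polynomial.Monic.irreducible_of_irreducible_map
    (η : MvPolynomial (Fin 2) ℚ →+* Polynomial ℚ) _ (hmonic.map _) ?_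
  rwa [Polynomial.map_map, hηθ]
end
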